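/- arXiv:2207.11787 — 2 statements merged into one kernel-verified Lean document; each statement's English description precedes it below -/
import Mathlib

section
/- Let N ∈ ℕ and let t ∈ {0,…,N}. For any non-constant polynomials v_1, …, v_N ∈ ℤ[x] such that v_1(x) − v_1(0), …, v_N(x) − v_N(0) are ℚ-linearly independent, there exist a strictly increasing sequence (n_k)_{k∈ℕ} in ℕ and a T ∈ Aut([0,1], ℬ, μ) with the property that for all measurable A, B ⊆ [0,1] and every j ∈ {1,…,N}, lim_{k→∞} μ(A ∩ T^{−v_j(n_k)} B) = μ(A ∩ B) if j ≤ t, and lim_{k→∞} μ(A ∩ T^{−v_j(n_k)} B) = μ(A) μ(B) if t < j ≤ N. -/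
open MeasureTheory Filter Topology

noncomputable section

/-- An invertible Lebesgue-measure-preserving transformation of `[0,1]`. -/
structure Aut01 : Type where
  toEquiv : unitInterval ≃ unitInterval
  measurePreserving_toFun :
    MeasurePreserving toEquiv (volume : Measure unitInterval) volume
  measurePreserving_invFun :
    MeasurePreserving toEquiv.symm (volume : Measure unitInterval) volume

namespace Aut01

/-- The correlation `μ(A ∩ T^{-m} B)` (as a real number). -/
def corr (T : Aut01) (m : ℤ) (A B : Set unitInterval) : ℝ :=
  (volume (A ∩ ⇑(T.toEquiv ^ m : Equiv.Perm unitInterval) ⁻¹' B)).toReal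

/-- The dyadic interval `[k/2^ℓ, (k+1)/2^ℓ)` of rank `ℓ`, as a subset of `[0,1]`. -/
def dyadic (ℓ k : ℕ) : Set unitInterval :=
  {x | (k : ℝ) / 2 ^ ℓ ≤ (x : ℝ) ∧ (x : ℝ) < ((k : ℝ) + 1) / 2 ^ ℓ}

/-- The metric `∂(T,S) = Σ_{ℓ≥1} 2^{-2ℓ} Σ_{E of rank ℓ} μ(TE △ SE)` inducing the weak
topology on `Aut01`. -/
def wDist (T S : Aut01) : ℝ :=
  ∑' ℓ : ℕ,
    (1 / 2 ^ (2 * (ℓ + 1)) : ℝ) *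
      ∑ k ∈ Finset.range (2 ^ (ℓ + 1)),
        (volume (symmDiff (T.toEquiv '' dyadic (ℓ + 1) k) (S.toEquiv '' dyadic (ℓ + 1) k))).toReal

/-- The weak topology on `Aut01`, generated by the balls of the metric `wDist`. -/
instance : TopologicalSpace Aut01 :=
  TopologicalSpace.generateFrom
    {U | ∃ (T : Aut01) (ε : ℝ), 0 < ε ∧ U = {S | wDist T S < ε}}

/-- `T` is aperiodic: the set of periodic points has measure zero. -/
def Aperiodic (T : Aut01) : Prop :=
  volume {x : unitInterval |
    ∃ n : ℕ, 0 < n ∧ (T.toEquiv ^ n : Equiv.Perm unitInterval) x = x} = 0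

/-- `T` is weakly mixing. -/
def WeaklyMixing (T : Aut01) : Prop :=
  ∀ A B : Set unitInterval, MeasurableSet A → MeasurableSet B →
    Tendsto
      (fun M : ℕ =>
        (1 / (M : ℝ)) *
          ∑ n ∈ Finset.Icc 1 M,
            |T.corr (n : ℤ) A B - (volume A).toReal * (volume B).toReal|)
      atTop (𝓝 0)

end Aut01

section CircleAutomorphisms

open AddCircle

/-- The Hilbert space of square-integrable functions on the circle. -/
abbrev CircleL2 : Type := Lp ℂ 2 (haarAddCircle : Measure UnitAddCircle)

/-- The Koopman operator `f ↦ f ∘ F` of a measure-preserving map of the circle. -/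
def koopman (F : UnitAddCircle → UnitAddCircle)
    (hF : MeasurePreserving F haarAddCircle haarAddCircle) : CircleL2 →ₗᵢ[ℂ] CircleL2 :=
  Lp.compMeasurePreservingₗᵢ ℂ F hF

lemma coeFn_koopman {F : UnitAddCircle → UnitAddCircle}
    (hF : MeasurePreserving F haarAddCircle haarAddCircle) (f : CircleL2) :
    koopman F hF f =ᵐ[haarAddCircle] f ∘ F :=
  Lp.coeFn_compMeasurePreserving f hF

lemma koopman_comp {F G : UnitAddCircle → UnitAddCircle}
    (hF : MeasurePreserving F haarAddCircle haarAddCircle)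
    (hG : MeasurePreserving G haarAddCircle haarAddCircle) (f : CircleL2) :
    koopman (F ∘ G) (hF.comp hG) f = koopman G hG (koopman F hF f) :=
  Lp.compMeasurePreserving_comp_apply f hF hG

lemma koopman_id (f : CircleL2) : koopman id (.id _) f = f :=
  Lp.compMeasurePreserving_id_apply f

/-- The `n`-th character of the circle as a square-integrable function. -/
abbrev charL2 (n : ℤ) : CircleL2 := fourierLp 2 n

lemma koopman_charL2 {F : UnitAddCircle → UnitAddCircle}
    (hF : MeasurePreserving F haarAddCircle haarAddCircle) (n : ℤ) :
    koopman F hF (charL2 n) =ᵐ[haarAddCircle] fun x => fourier n (F x) := by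
  refine (coeFn_koopman hF _).trans ?_
  exact hF.quasiMeasurePreserving.ae_eq_comp (coeFn_fourierLp 2 n)

lemma norm_fourier_apply (n : ℤ) (x : UnitAddCircle) : ‖fourier n x‖ = 1 := by
  rw [fourier_apply]; exact Circle.norm_coe _

lemma norm_fourier_sub_le (n : ℤ) (x y : UnitAddCircle) :
    ‖fourier n x - fourier n y‖ ≤ |(n : ℝ)| * ‖fourier 1 x - fourier 1 y‖ := by
  have nat (n : ℕ) : ‖fourier (n : ℤ) x - fourier (n : ℤ) y‖ ≤
      (n : ℝ) * ‖fourier 1 x - fourier 1 y‖ := by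
    induction n with
    | zero => simp
    | succ n ih =>
      push_cast
      rw [fourier_add, fourier_add]
      calc _ = ‖(fourier (n : ℤ) x - fourier (n : ℤ) y) * fourier 1 x +
              fourier (n : ℤ) y * (fourier 1 x - fourier 1 y)‖ := by ring_nf
        _ ≤ _ := (norm_add_le _ _).trans (by
            rw [norm_mul, norm_mul, norm_fourier_apply, norm_fourier_apply]; linarith)
  obtain ⟨k, rfl | rfl⟩ := n.eq_nat_or_neg
  · simpa using nat k
  · rw [fourier_neg, fourier_neg, ← map_sub, Complex.norm_conj]
    simpa using nat k

/-- Pointwise convergence of an equi-Lipschitz family can be tested on a dense set. -/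
lemma tendsto_of_lipschitz_of_dense {E F ι : Type*} [PseudoMetricSpace E] [PseudoMetricSpace F]
    {l : Filter ι} {φ : ι → E → F} {φ₀ : E → F} {K : NNReal} (hφ : ∀ i, LipschitzWith K (φ i))
    (hφ₀ : LipschitzWith K φ₀) {s : Set E} (hs : Dense s)
    (h : ∀ f ∈ s, Tendsto (fun i => φ i f) l (𝓝 (φ₀ f))) (f : E) :
    Tendsto (fun i => φ i f) l (𝓝 (φ₀ f)) := by
  rw [Metric.tendsto_nhds]
  intro ε hε
  obtain ⟨g, hg, hfg⟩ := hs.exists_dist_lt f (ε := ε / (3 * (K + 1))) (by positivity)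
  have hK : K * dist f g < ε / 3 := by
    rw [lt_div_iff₀ (by positivity)] at hfg
    nlinarith [dist_nonneg (x := f) (y := g), K.2]
  filter_upwards [Metric.tendsto_nhds.1 (h g hg) (ε / 3) (by positivity)] with i hi
  have h1 := (hφ i).dist_le_mul f g
  have h2 := hφ₀.dist_le_mul f g
  calc dist (φ i f) (φ₀ f) ≤ dist (φ i f) (φ i g) + dist (φ i g) (φ₀ g) + dist (φ₀ g) (φ₀ f) :=
        dist_triangle4 _ _ _ _
    _ < ε := by rw [dist_comm (φ₀ g)]; linarith

lemma dense_span_range_charL2 :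
    Dense (Submodule.span ℂ (Set.range charL2) : Set CircleL2) := by
  rw [Submodule.dense_iff_topologicalClosure_eq_top]
  exact span_fourierLp_closure_eq_top (by simp)

lemma koopman_tendsto {ι : Type*} {l : Filter ι} {F : ι → UnitAddCircle → UnitAddCircle}
    (hF : ∀ i, MeasurePreserving (F i) haarAddCircle haarAddCircle)
    {F₀ : UnitAddCircle → UnitAddCircle} (hF₀ : MeasurePreserving F₀ haarAddCircle haarAddCircle)
    (h : Tendsto (fun i => koopman (F i) (hF i) (charL2 1)) l (𝓝 (koopman F₀ hF₀ (charL2 1))))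
    (f : CircleL2) :
    Tendsto (fun i => koopman (F i) (hF i) f) l (𝓝 (koopman F₀ hF₀ f)) := by
  refine tendsto_of_lipschitz_of_dense (φ := fun i => koopman (F i) (hF i))
    (fun i => (koopman (F i) (hF i)).lipschitz) (koopman F₀ hF₀).lipschitz
    dense_span_range_charL2 (fun f hf => ?_) f
  induction hf using Submodule.span_induction with
  | zero => simpa using tendsto_const_nhds
  | add x y _ _ hx hy => simpa using hx.add hy
  | smul a x _ hx => simpa using hx.const_smul a
  | mem x hx =>
  obtain ⟨n, rfl⟩ := hx
  rw [tendsto_iff_norm_sub_tendsto_zero] at h ⊢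
  refine squeeze_zero (fun _ => norm_nonneg _) (fun i => ?_) (by simpa using h.const_mul |(n : ℝ)|)
  refine Lp.norm_le_mul_norm_of_ae_le_mul ?_
  filter_upwards [Lp.coeFn_sub (koopman (F i) (hF i) (charL2 n)) (koopman F₀ hF₀ (charL2 n)),
    Lp.coeFn_sub (koopman (F i) (hF i) (charL2 1)) (koopman F₀ hF₀ (charL2 1)),
    koopman_charL2 (hF i) n, koopman_charL2 hF₀ n, koopman_charL2 (hF i) 1,
    koopman_charL2 hF₀ 1] with x h1 h2 h3 h4 h5 h6
  rw [h1, h2, Pi.sub_apply, Pi.sub_apply, h3, h4, h5, h6]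
  exact norm_fourier_sub_le n _ _

/-- Weak convergence of Koopman operators can be tested on characters. -/
lemma tendsto_inner_of_charL2 {ι : Type*} {l : Filter ι} (V : ι → CircleL2 →ₗᵢ[ℂ] CircleL2)
    (W : CircleL2 →L[ℂ] CircleL2)
    (h : ∀ m n, Tendsto (fun i => inner ℂ (charL2 m) (V i (charL2 n))) l
      (𝓝 (inner ℂ (charL2 m) (W (charL2 n)))))
    (f g : CircleL2) :
    Tendsto (fun i => inner ℂ f (V i g)) l (𝓝 (inner ℂ f (W g))) := by
  have lip (f : CircleL2) (A : CircleL2 →L[ℂ] CircleL2) (K : NNReal) (hK : ∀ g, ‖A g‖ ≤ K * ‖g‖) :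
      LipschitzWith (‖f‖₊ * K) fun g => inner ℂ f (A g) := by
    refine LipschitzWith.of_dist_le_mul fun x y => ?_
    rw [dist_eq_norm, dist_eq_norm, ← inner_sub_right, ← map_sub]
    refine (norm_inner_le_norm _ _).trans ?_
    push_cast
    rw [mul_assoc]
    exact mul_le_mul_of_nonneg_left (hK _) (norm_nonneg _)
  have lip' (g : CircleL2) (K : NNReal) (hK : ‖g‖ ≤ K) :
      LipschitzWith K fun f : CircleL2 => inner ℂ f g := by
    refine LipschitzWith.of_dist_le_mul fun x y => ?_
    rw [dist_eq_norm, dist_eq_norm, ← inner_sub_left, mul_comm]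
    exact (norm_inner_le_norm _ _).trans (mul_le_mul_of_nonneg_left hK (norm_nonneg _))
  have key (m : ℤ) (g : CircleL2) : Tendsto (fun i => inner ℂ (charL2 m) (V i g)) l
      (𝓝 (inner ℂ (charL2 m) (W g))) := by
    refine tendsto_of_lipschitz_of_dense (φ := fun i g => inner ℂ (charL2 m) (V i g))
      (fun i => lip _ (V i).toContinuousLinearMap (max 1 ‖W‖₊) fun g => ?_)
      (lip _ W (max 1 ‖W‖₊) fun g => ?_) dense_span_range_charL2 (fun f hf => ?_) g
    · simpa using le_mul_of_one_le_left (norm_nonneg g) (le_max_left _ _)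
    · exact (W.le_opNorm g).trans (mul_le_mul_of_nonneg_right (by simp) (norm_nonneg _))
    induction hf using Submodule.span_induction with
    | zero => simpa using tendsto_const_nhds
    | add x y _ _ hx hy => simpa [inner_add_right] using hx.add hy
    | smul a x _ hx => simpa [inner_smul_right] using hx.const_mul a
    | mem x hx => obtain ⟨n, rfl⟩ := hx; exact h m n
  refine tendsto_of_lipschitz_of_dense (φ := fun i f => inner ℂ f (V i g))
      (K := max ‖g‖₊ ‖W g‖₊)
      (fun i => lip' (V i g) _ ?_) (lip' (W g) _ ?_) dense_span_range_charL2 (fun f hf => ?_) f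
  · simp
  · simp
  induction hf using Submodule.span_induction with
  | zero => simpa using tendsto_const_nhds
  | add x y _ _ hx hy => simpa [inner_add_left] using hx.add hy
  | smul a x _ hx => simpa [inner_smul_left] using hx.const_mul (starRingEnd ℂ a)
  | mem x hx => obtain ⟨m, rfl⟩ := hx; exact key m g

/-- Permutations of the circle preserving Haar measure in both directions. -/
def circleAutSubgroup : Subgroup (Equiv.Perm UnitAddCircle) where
  carrier := {e | MeasurePreserving e haarAddCircle haarAddCircle ∧
    MeasurePreserving e.symm haarAddCircle haarAddCircle}
  mul_mem' ha hb := ⟨ha.1.comp hb.1, hb.2.comp ha.2⟩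
  one_mem' := ⟨.id _, .id _⟩
  inv_mem' h := ⟨h.2, h.1⟩

/-- The group of invertible measure-preserving transformations of the circle. -/
def CircleAut : Type := circleAutSubgroup

namespace CircleAut

instance : Group CircleAut := inferInstanceAs (Group circleAutSubgroup)

instance : CoeFun CircleAut fun _ => UnitAddCircle → UnitAddCircle := ⟨fun T => T.1⟩

lemma measurePreserving (T : CircleAut) : MeasurePreserving T haarAddCircle haarAddCircle := T.2.1

/-- The Koopman operator of an automorphism. -/
def koop (T : CircleAut) : CircleL2 →ₗᵢ[ℂ] CircleL2 := koopman T T.measurePreserving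

lemma koop_mul (T S : CircleAut) (f : CircleL2) : (T * S).koop f = S.koop (T.koop f) :=
  koopman_comp T.measurePreserving S.measurePreserving f

lemma koop_one (f : CircleL2) : (1 : CircleAut).koop f = f := koopman_id f

lemma mul_apply (T S : CircleAut) (x : UnitAddCircle) : (T * S) x = T (S x) := rfl

lemma ext {T S : CircleAut} (h : ∀ x, T x = S x) : T = S :=
  Subtype.ext (Equiv.ext h)

/-- The metric inducing the weak topology. -/
instance : PseudoMetricSpace CircleAut :=
  PseudoMetricSpace.induced (fun T => (T.koop (charL2 1), T⁻¹.koop (charL2 1))) inferInstance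

lemma tendsto_iff {ι : Type*} {l : Filter ι} {T : ι → CircleAut} {S : CircleAut} :
    Tendsto T l (𝓝 S) ↔
      Tendsto (fun i => (T i).koop (charL2 1)) l (𝓝 (S.koop (charL2 1))) ∧
      Tendsto (fun i => (T i)⁻¹.koop (charL2 1)) l (𝓝 (S⁻¹.koop (charL2 1))) := by
  have h : IsInducing fun T : CircleAut => (T.koop (charL2 1), T⁻¹.koop (charL2 1)) := ⟨rfl⟩
  rw [h.tendsto_nhds_iff, nhds_prod_eq, tendsto_prod_iff']
  rfl

lemma tendsto_koop {ι : Type*} {l : Filter ι} {T : ι → CircleAut} {S : CircleAut}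
    (h : Tendsto T l (𝓝 S)) (f : CircleL2) :
    Tendsto (fun i => (T i).koop f) l (𝓝 (S.koop f)) :=
  koopman_tendsto _ _ (tendsto_iff.1 h).1 f

lemma tendsto_koop_apply {ι : Type*} {l : Filter ι} {T : ι → CircleAut} {S : CircleAut}
    (h : Tendsto T l (𝓝 S)) {f : ι → CircleL2} {g : CircleL2} (hf : Tendsto f l (𝓝 g)) :
    Tendsto (fun i => (T i).koop (f i)) l (𝓝 (S.koop g)) := by
  have h1 : Tendsto (fun i => (T i).koop (f i - g)) l (𝓝 0) := by
    rw [tendsto_zero_iff_norm_tendsto_zero]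
    simpa only [LinearIsometry.norm_map] using tendsto_iff_norm_sub_tendsto_zero.1 hf
  simpa using h1.add (tendsto_koop h g)

instance : IsTopologicalGroup CircleAut where
  continuous_mul := by
    rw [continuous_iff_continuousAt]
    rintro ⟨T, S⟩
    have h1 : Tendsto (fun p : CircleAut × CircleAut => p.1) (𝓝 (T, S)) (𝓝 T) :=
      continuous_fst.tendsto _
    have h2 : Tendsto (fun p : CircleAut × CircleAut => p.2) (𝓝 (T, S)) (𝓝 S) :=
      continuous_snd.tendsto _
    refine tendsto_iff.2 ⟨?_, ?_⟩
    · simp only [koop_mul]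
      exact tendsto_koop_apply h2 (tendsto_iff.1 h1).1
    · have h1' : Tendsto (fun p : CircleAut × CircleAut => p.1⁻¹) (𝓝 (T, S)) (𝓝 T⁻¹) :=
        tendsto_iff.2 ⟨(tendsto_iff.1 h1).2, by simpa using (tendsto_iff.1 h1).1⟩
      simp only [mul_inv_rev, koop_mul]
      exact tendsto_koop_apply h1' (tendsto_iff.1 h2).2
  continuous_inv := by
    rw [continuous_iff_continuousAt]
    intro T
    have h : Tendsto (fun T : CircleAut => T) (𝓝 T) (𝓝 T) := tendsto_id
    exact tendsto_iff.2 ⟨(tendsto_iff.1 h).2, by simpa using (tendsto_iff.1 h).1⟩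

lemma continuous_koop_zpow (m : ℤ) (f : CircleL2) :
    Continuous fun T : CircleAut => (T ^ m).koop f :=
  continuous_iff_continuousAt.2 fun _ => tendsto_koop ((continuous_zpow m).tendsto _) f

open Classical in
/-- A measure-preserving map that is invertible modulo null sets agrees almost everywhere with
an automorphism. -/
lemma exists_ae_eq {F S : UnitAddCircle → UnitAddCircle}
    (hF : MeasurePreserving F haarAddCircle haarAddCircle)
    (hS : MeasurePreserving S haarAddCircle haarAddCircle)
    (hSF : ∀ᵐ x ∂haarAddCircle, S (F x) = x) (hFS : ∀ᵐ x ∂haarAddCircle, F (S x) = x) :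
    ∃ T : CircleAut, T =ᵐ[haarAddCircle] F ∧ (T⁻¹ : CircleAut) =ᵐ[haarAddCircle] S := by
  set G : Set UnitAddCircle := {x | S (F x) = x ∧ F (S x) = x}
  have hG : MeasurableSet G :=
    (measurableSet_eq_fun (hS.measurable.comp hF.measurable) measurable_id).inter
      (measurableSet_eq_fun (hF.measurable.comp hS.measurable) measurable_id)
  set Y : Set UnitAddCircle := {x | ∀ n : ℕ, F^[n] x ∈ G ∧ S^[n] x ∈ G}
  have hYae : ∀ᵐ x ∂haarAddCircle, x ∈ Y := by
    have hGae : ∀ᵐ x ∂haarAddCircle, x ∈ G := hSF.and hFS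
    refine ae_all_iff.2 fun n => ?_
    exact ((hF.iterate n).quasiMeasurePreserving.ae hGae).and
      ((hS.iterate n).quasiMeasurePreserving.ae hGae)
  have hY : MeasurableSet Y := by
    have : Y = ⋂ n : ℕ, (F^[n] ⁻¹' G ∩ S^[n] ⁻¹' G) := by ext; simp [Y]
    rw [this]
    exact .iInter fun n => ((hF.iterate n).measurable hG).inter ((hS.iterate n).measurable hG)
  have hYG : ∀ x ∈ Y, S (F x) = x ∧ F (S x) = x := fun x hx => (hx 0).1
  have hFY : ∀ x ∈ Y, F x ∈ Y := by
    intro x hx n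
    refine ⟨(hx (n + 1)).1, ?_⟩
    cases n with
    | zero => exact (hx 1).1
    | succ n => rw [Function.iterate_succ_apply, (hYG x hx).1]; exact (hx n).2
  have hSY : ∀ x ∈ Y, S x ∈ Y := by
    intro x hx n
    refine ⟨?_, (hx (n + 1)).2⟩
    cases n with
    | zero => exact (hx 1).2
    | succ n => rw [Function.iterate_succ_apply, (hYG x hx).2]; exact (hx n).1
  let e : Equiv.Perm UnitAddCircle :=
    { toFun x := if x ∈ Y then F x else x
      invFun x := if x ∈ Y then S x else x
      left_inv x := by
        by_cases hx : x ∈ Y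
        · simp [hx, hFY x hx, (hYG x hx).1]
        · simp [hx]
      right_inv x := by
        by_cases hx : x ∈ Y
        · simp [hx, hSY x hx, (hYG x hx).2]
        · simp [hx] }
  have he : e =ᵐ[haarAddCircle] F := by
    filter_upwards [hYae] with x hx using if_pos hx
  have he' : e.symm =ᵐ[haarAddCircle] S := by
    filter_upwards [hYae] with x hx using if_pos hx
  refine ⟨⟨e, ⟨hF.measurable.ite hY measurable_id, ?_⟩,
    ⟨hS.measurable.ite hY measurable_id, ?_⟩⟩, he, he'⟩
  · rw [Measure.map_congr he, hF.map_eq]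
  · rw [Measure.map_congr he', hS.map_eq]

end CircleAut

lemma exists_koopman_eq_of_tendsto {F : ℕ → UnitAddCircle → UnitAddCircle}
    (hF : ∀ i, MeasurePreserving (F i) haarAddCircle haarAddCircle) {f : CircleL2}
    (h : Tendsto (fun i => koopman (F i) (hF i) (charL2 1)) atTop (𝓝 f)) :
    ∃ (F₀ : UnitAddCircle → UnitAddCircle) (hF₀ : MeasurePreserving F₀ haarAddCircle haarAddCircle),
      koopman F₀ hF₀ (charL2 1) = f := by
  obtain ⟨ns, -, hns⟩ := (tendstoInMeasure_of_tendsto_Lp h).exists_seq_tendsto_ae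
  have hns' : ∀ᵐ x ∂haarAddCircle,
      Tendsto (fun k => (fourier 1 (F (ns k) x) : ℂ)) atTop (𝓝 (f x)) := by
    filter_upwards [hns, ae_all_iff.2 fun k => koopman_charL2 (hF (ns k)) 1] with x hx hx'
    simpa only [hx'] using hx
  have hlim : ∀ᵐ x ∂haarAddCircle, ∃ y, Tendsto (fun k => F (ns k) x) atTop (𝓝 y) := by
    filter_upwards [hns'] with x hx
    have hnorm : ‖f x‖ = 1 := by
      refine tendsto_nhds_unique hx.norm ?_
      simpa only [norm_fourier_apply] using tendsto_const_nhds
    let z : Circle := ⟨f x, by simpa [Submonoid.unitSphere] using hnorm⟩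
    let e := AddCircle.homeomorphCircle (T := (1 : ℝ)) one_ne_zero
    refine ⟨e.symm z, ?_⟩
    have h1 : Tendsto (fun k => e (F (ns k) x)) atTop (𝓝 z) := by
      refine (IsInducing.mk rfl : IsInducing ((↑) : Circle → ℂ)).tendsto_nhds_iff.2 ?_
      have h2 : Tendsto (fun k => ((e (F (ns k) x) : Circle) : ℂ)) atTop (𝓝 (f x)) := by
        simpa [e, AddCircle.homeomorphCircle_apply, fourier_one] using hx
      exact h2
    simpa [Function.comp_def] using (e.symm.continuous.tendsto z).comp h1
  obtain ⟨F₀, hm, hF₀⟩ := measurable_limit_of_tendsto_metrizable_ae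
    (fun k => (hF (ns k)).measurable.aemeasurable) hlim
  have hmp : MeasurePreserving F₀ haarAddCircle haarAddCircle := by
    refine ⟨hm, ?_⟩
    have : IsFiniteMeasure (Measure.map F₀ (haarAddCircle (T := 1))) := inferInstance
    refine ext_of_forall_integral_eq_of_IsFiniteMeasure fun φ => ?_
    rw [integral_map hm.aemeasurable φ.continuous.aestronglyMeasurable]
    have h1 : Tendsto (fun k => ∫ x, φ (F (ns k) x) ∂(haarAddCircle (T := 1))) atTop
        (𝓝 (∫ x, φ (F₀ x) ∂haarAddCircle)) := by
      refine tendsto_integral_of_dominated_convergence (fun _ => ‖φ‖)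
        (fun k => ?_) (integrable_const _) (fun k => .of_forall fun x => φ.norm_coe_le_norm _) ?_
      · exact (φ.continuous.measurable.comp (hF (ns k)).measurable).aestronglyMeasurable
      · filter_upwards [hF₀] with x hx using (φ.continuous.tendsto _).comp hx
    refine tendsto_nhds_unique h1 ?_
    have h2 (k : ℕ) : ∫ x, φ (F (ns k) x) ∂(haarAddCircle (T := 1)) = ∫ x, φ x ∂haarAddCircle := by
      conv_rhs => rw [← (hF (ns k)).map_eq]
      rw [integral_map (hF (ns k)).measurable.aemeasurable φ.continuous.aestronglyMeasurable]
    simp [h2]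
  refine ⟨F₀, hmp, Lp.ext ?_⟩
  filter_upwards [koopman_charL2 hmp 1, hns', hF₀] with x h1 h2 h3
  rw [h1]
  exact tendsto_nhds_unique (((fourier 1).continuous.tendsto _).comp h3) h2

lemma ae_eq_id_of_koopman {F : UnitAddCircle → UnitAddCircle}
    (hF : MeasurePreserving F haarAddCircle haarAddCircle)
    (h : koopman F hF (charL2 1) = charL2 1) : ∀ᵐ x ∂haarAddCircle, F x = x := by
  filter_upwards [koopman_charL2 hF 1, coeFn_fourierLp 2 1] with x h1 h2
  rw [h, h2] at h1
  rw [fourier_one, fourier_one] at h1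
  exact (AddCircle.injective_toCircle one_ne_zero (Circle.ext h1)).symm

namespace CircleAut

lemma ae_leftInverse_of_tendsto {u : ℕ → CircleAut} {F S : UnitAddCircle → UnitAddCircle}
    (hF : MeasurePreserving F haarAddCircle haarAddCircle)
    (hS : MeasurePreserving S haarAddCircle haarAddCircle)
    (hu : Tendsto (fun i => (u i).koop (charL2 1)) atTop (𝓝 (koopman F hF (charL2 1))))
    (hu' : Tendsto (fun i => (u i)⁻¹.koop (charL2 1)) atTop (𝓝 (koopman S hS (charL2 1)))) :
    ∀ᵐ x ∂haarAddCircle, S (F x) = x := by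
  refine ae_eq_id_of_koopman (hS.comp hF) ?_
  refine (koopman_comp hS hF _).trans ?_
  have h1 := koopman_tendsto (fun i => (u i).measurePreserving) hF hu (koopman S hS (charL2 1))
  refine tendsto_nhds_unique h1 ?_
  rw [tendsto_iff_norm_sub_tendsto_zero] at hu' ⊢
  refine hu'.congr fun i => ?_
  have h2 : (u i).koop (koopman S hS (charL2 1) - (u i)⁻¹.koop (charL2 1)) =
      (u i).koop (koopman S hS (charL2 1)) - charL2 1 := by
    rw [map_sub, ← koop_mul, inv_mul_cancel, koop_one]
  rw [norm_sub_rev, ← (u i).koop.norm_map, h2]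
  rfl

instance : CompleteSpace CircleAut := by
  refine Metric.complete_of_cauchySeq_tendsto fun u hu => ?_
  have hΦ : CauchySeq fun i => ((u i).koop (charL2 1), (u i)⁻¹.koop (charL2 1)) := by
    rw [Metric.cauchySeq_iff] at hu ⊢
    exact hu
  obtain ⟨⟨f, g⟩, hfg⟩ := cauchySeq_tendsto_of_complete hΦ
  rw [nhds_prod_eq, tendsto_prod_iff'] at hfg
  obtain ⟨F, hF, rfl⟩ := exists_koopman_eq_of_tendsto (fun i => (u i).measurePreserving) hfg.1
  obtain ⟨S, hS, rfl⟩ := exists_koopman_eq_of_tendsto (fun i => (u i)⁻¹.measurePreserving) hfg.2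
  obtain ⟨T, hTF, hTS⟩ := exists_ae_eq hF hS (ae_leftInverse_of_tendsto hF hS hfg.1 hfg.2)
    (ae_leftInverse_of_tendsto (u := fun i => (u i)⁻¹) hS hF hfg.2 (by simpa using hfg.1))
  have hT : T.koop (charL2 1) = koopman F hF (charL2 1) := by
    refine Lp.ext ?_
    filter_upwards [koopman_charL2 T.measurePreserving 1, koopman_charL2 hF 1, hTF] with x h1 h2 h3
    exact h1.trans (by rw [h2, h3])
  have hT' : T⁻¹.koop (charL2 1) = koopman S hS (charL2 1) := by
    refine Lp.ext ?_
    filter_upwards [koopman_charL2 T⁻¹.measurePreserving 1, koopman_charL2 hS 1, hTS]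
      with x h1 h2 h3
    exact h1.trans (by rw [h2, h3])
  exact ⟨T, tendsto_iff.2 ⟨hT ▸ hfg.1, hT' ▸ hfg.2⟩⟩

end CircleAut

namespace CircleAut

/-- The rotation by `a`. -/
def rot (a : UnitAddCircle) : CircleAut :=
  ⟨Equiv.addRight a, measurePreserving_add_right _ a, by
    simpa [sub_eq_add_neg] using measurePreserving_add_right haarAddCircle (-a)⟩

lemma rot_apply (a x : UnitAddCircle) : rot a x = x + a := rfl

lemma rot_add (a b : UnitAddCircle) : rot (a + b) = rot a * rot b :=
  ext fun x => by rw [mul_apply, rot_apply, rot_apply, rot_apply]; abel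

lemma rot_zero : rot 0 = 1 := ext fun x => add_zero x

/-- Rotations as a one-parameter group. -/
def rotHom : Multiplicative UnitAddCircle →* CircleAut where
  toFun a := rot a.toAdd
  map_one' := rot_zero
  map_mul' a b := rot_add a.toAdd b.toAdd

lemma rot_zsmul (m : ℤ) (a : UnitAddCircle) : rot (m • a) = rot a ^ m :=
  map_zpow rotHom (Multiplicative.ofAdd a) m

lemma rot_neg (a : UnitAddCircle) : rot (-a) = (rot a)⁻¹ :=
  map_inv rotHom (Multiplicative.ofAdd a)

lemma koop_rot (a : UnitAddCircle) (n : ℤ) :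
    (rot a).koop (charL2 n) = fourier n a • charL2 n := by
  refine Lp.ext ?_
  filter_upwards [koopman_charL2 (rot a).measurePreserving n, coeFn_fourierLp 2 n,
    Lp.coeFn_smul (fourier n a) (charL2 n)] with x h1 h2 h3
  refine h1.trans ?_
  rw [h3, Pi.smul_apply, h2, rot_apply, smul_eq_mul, fourier_apply, fourier_apply, fourier_apply,
    smul_add, toCircle_add, Circle.coe_mul, mul_comm]

lemma continuous_rot : Continuous rot := by
  refine continuous_iff_continuousAt.2 fun a => tendsto_iff.2 ⟨?_, ?_⟩
  · simp only [koop_rot]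
    exact ((fourier 1).continuous.tendsto a).smul_const _
  · simp only [← rot_neg, koop_rot]
    exact (((fourier 1).continuous.comp continuous_neg).tendsto a).smul_const _

end CircleAut

/-- A translation depending on a label that is invariant under the translations used. -/
lemma measurePreserving_add_label {ι : Type*} [Countable ι] [MeasurableSpace ι]
    [MeasurableSingletonClass ι] {d : UnitAddCircle → ι} (hd : Measurable d)
    (τ : ι → UnitAddCircle) (h : ∀ x i, d (x + τ i) = d x) :
    MeasurePreserving (fun x => x + τ (d x)) haarAddCircle haarAddCircle := by
  have hm : Measurable fun x => x + τ (d x) :=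
    measurable_id.add ((measurable_of_countable τ).comp hd)
  refine ⟨hm, Measure.ext fun B hB => ?_⟩
  rw [Measure.map_apply hm hB]
  have hsplit (A : Set UnitAddCircle) (hA : MeasurableSet A) :
      haarAddCircle A = ∑' i, haarAddCircle (A ∩ d ⁻¹' {i}) := by
    rw [← measure_iUnion]
    · congr 1; ext x; simp
    · intro i j hij
      refine Set.disjoint_left.2 fun x hx hx' => hij ?_
      exact hx.2.symm.trans hx'.2
    · exact fun i => hA.inter (hd (measurableSet_singleton i))
  rw [hsplit _ (hm hB), hsplit _ hB]
  refine tsum_congr fun i => ?_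
  rw [← (measurePreserving_add_right haarAddCircle (τ i)).measure_preimage
    (hB.inter (hd (measurableSet_singleton i))).nullMeasurableSet]
  congr 1
  ext x
  simp only [Set.mem_inter_iff, Set.mem_preimage, Set.mem_singleton_iff, h]
  constructor
  · rintro ⟨h1, rfl⟩; exact ⟨h1, rfl⟩
  · rintro ⟨h1, rfl⟩; exact ⟨h1, rfl⟩

lemma periodic_digit (q : ℕ) : Function.Periodic (fun r : ℝ => (⌊(q : ℝ) ^ 2 * r⌋ : ZMod q)) 1 := by
  intro r
  have : (q : ℝ) ^ 2 * (r + 1) = (q : ℝ) ^ 2 * r + ((q ^ 2 : ℤ) : ℝ) := by push_cast; ring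
  simp only [this, Int.floor_add_intCast]
  simp

/-- The second digit of a point of the circle in base `q`. -/
def digit (q : ℕ) : UnitAddCircle → ZMod q := (periodic_digit q).lift

lemma digit_coe (q : ℕ) (r : ℝ) : digit q r = (⌊(q : ℝ) ^ 2 * r⌋ : ZMod q) := rfl

lemma measurable_digit (q : ℕ) : Measurable (digit q) := by
  refine QuotientAddGroup.measurable_from_quotient.2 ?_
  have : Measurable fun r : ℝ => ⌊(q : ℝ) ^ 2 * r⌋ :=
    Int.measurable_floor.comp (measurable_id.const_mul _)
  exact (measurable_of_countable (fun z : ℤ => (z : ZMod q))).comp this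

lemma digit_add_of_nsmul_eq_zero (q : ℕ) {a : UnitAddCircle} (ha : q • a = 0) (x : UnitAddCircle) :
    digit q (x + a) = digit q x := by
  induction x using QuotientAddGroup.induction_on with
  | H r =>
  induction a using QuotientAddGroup.induction_on with
  | H s =>
  change ((q • s : ℝ) : UnitAddCircle) = 0 at ha
  obtain ⟨m, hm⟩ := (coe_eq_zero_iff (1 : ℝ)).1 ha
  have hm' : (q : ℝ) * s = m := by simpa using hm.symm
  have : (q : ℝ) ^ 2 * (r + s) = (q : ℝ) ^ 2 * r + ((q * m : ℤ) : ℝ) := by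
    push_cast; rw [← hm']; ring
  change digit q ((r + s : ℝ) : UnitAddCircle) = digit q (r : UnitAddCircle)
  rw [digit_coe, digit_coe, this, Int.floor_add_intCast]
  simp

section Digit

variable (q : ℕ) [NeZero q]

lemma digit_add_inv_sq (x : UnitAddCircle) :
    digit q (x + (((q : ℝ) ^ 2)⁻¹ : ℝ)) = digit q x + 1 := by
  induction x using QuotientAddGroup.induction_on with
  | H r =>
  have hq : (q : ℝ) ≠ 0 := NeZero.ne _
  have : (q : ℝ) ^ 2 * (r + ((q : ℝ) ^ 2)⁻¹) = (q : ℝ) ^ 2 * r + 1 := by field_simp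
  change digit q ((r + ((q : ℝ) ^ 2)⁻¹ : ℝ) : UnitAddCircle) = digit q (r : UnitAddCircle) + 1
  rw [digit_coe, digit_coe, this, Int.floor_add_one]
  push_cast
  rfl

lemma digit_add_toAddCircle (j : ZMod q) (x : UnitAddCircle) :
    digit q (x + ZMod.toAddCircle j) = digit q x :=
  digit_add_of_nsmul_eq_zero q (by rw [← map_nsmul]; simp) x

namespace CircleAut

/-- The conjugating map `x ↦ x + d(x)² / q`, where `d` is the digit function. -/
def shear : CircleAut :=
  ⟨{ toFun x := x + ZMod.toAddCircle (digit q x ^ 2)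
     invFun x := x + ZMod.toAddCircle (-digit q x ^ 2)
     left_inv x := by
      simp only [digit_add_toAddCircle]
      rw [add_assoc, ← map_add, add_neg_cancel, map_zero, add_zero]
     right_inv x := by
      simp only [digit_add_toAddCircle]
      rw [add_assoc, ← map_add, neg_add_cancel, map_zero, add_zero] },
   measurePreserving_add_label (measurable_digit q) (fun j => ZMod.toAddCircle (j ^ 2))
    fun x i => digit_add_toAddCircle q _ x,
   measurePreserving_add_label (measurable_digit q) (fun j => ZMod.toAddCircle (-j ^ 2))
    fun x i => digit_add_toAddCircle q _ x⟩

lemma shear_apply (x : UnitAddCircle) :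
    shear q x = x + ZMod.toAddCircle (digit q x ^ 2) := rfl

lemma shear_inv_apply (x : UnitAddCircle) :
    (shear q)⁻¹ x = x + ZMod.toAddCircle (-digit q x ^ 2) := rfl

lemma commute_shear_rot {a : UnitAddCircle} (ha : q • a = 0) : Commute (shear q) (rot a) := by
  refine ext fun x => ?_
  rw [mul_apply, mul_apply, rot_apply, rot_apply, shear_apply, shear_apply,
    digit_add_of_nsmul_eq_zero q ha]
  abel

/-- The conjugate by `shear q` of the rotation by `1 / q ^ 2`. -/
def mixer : CircleAut := shear q * rot (((q : ℝ) ^ 2)⁻¹ : ℝ) * (shear q)⁻¹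

lemma mixer_apply (x : UnitAddCircle) :
    mixer q x = x + (((q : ℝ) ^ 2)⁻¹ : ℝ) + ZMod.toAddCircle (2 * digit q x + 1) := by
  have h (a b : UnitAddCircle) (j : ZMod q) :
      digit q (a + ZMod.toAddCircle j + b) = digit q (a + b) := by
    rw [add_right_comm, digit_add_toAddCircle]
  rw [mixer, mul_apply, mul_apply, shear_inv_apply, rot_apply, shear_apply, h, digit_add_inv_sq,
    show 2 * digit q x + 1 = -digit q x ^ 2 + (digit q x + 1) ^ 2 by ring, map_add]
  abel

lemma mixer_add_inv_sq (x : UnitAddCircle) :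
    mixer q (x + (((q : ℝ) ^ 2)⁻¹ : ℝ)) =
      mixer q x + ((((q : ℝ) ^ 2)⁻¹ : ℝ) + ZMod.toAddCircle (2 : ZMod q)) := by
  rw [mixer_apply, mixer_apply, digit_add_inv_sq,
    show 2 * (digit q x + 1) + 1 = (2 * digit q x + 1) + 2 by ring, map_add]
  abel

end CircleAut
end Digit

lemma inner_charL2_koop (T : CircleAut) (m n : ℤ) :
    inner ℂ (charL2 m) (T.koop (charL2 n)) =
      ∫ x, fourier (-m) x * fourier n (T x) ∂haarAddCircle := by
  rw [L2.inner_def]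
  refine integral_congr_ae ?_
  filter_upwards [koopman_charL2 T.measurePreserving n, coeFn_fourierLp 2 m] with x h1 h2
  rw [fourier_neg, h2]
  change inner ℂ _ (koopman T T.measurePreserving (charL2 n) x) = _
  rw [h1, RCLike.inner_apply, mul_comm]

lemma fourier_add_apply (n : ℤ) (x y : UnitAddCircle) :
    fourier n (x + y) = fourier n x * fourier n y := by
  simp only [fourier_apply, smul_add, toCircle_add, Circle.coe_mul]

lemma inner_charL2_mixer (q : ℕ) [NeZero q] (m n : ℤ) (h0 : n - m + 2 * n * q ≠ 0)
    (hlt : |n - m + 2 * n * q| < q ^ 2) :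
    inner ℂ (charL2 m) ((CircleAut.mixer q).koop (charL2 n)) = 0 := by
  rw [inner_charL2_koop]
  set γ : UnitAddCircle := ((((q : ℝ) ^ 2)⁻¹ : ℝ) : UnitAddCircle) with hγ
  set δ : UnitAddCircle := γ + ZMod.toAddCircle (2 : ZMod q) with hδ
  set ω : ℂ := fourier (-m) γ * fourier n δ with hω
  have hq : (q : ℝ) ≠ 0 := NeZero.ne _
  have hω1 : ω ≠ 1 := by
    have h2 : (ZMod.toAddCircle (2 : ZMod q) : UnitAddCircle) = ((2 / q : ℝ) : UnitAddCircle) := by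
      simpa using ZMod.toAddCircle_natCast (N := q) 2
    have hωz : ω = toCircle (((n - m + 2 * n * q : ℤ) / (q : ℝ) ^ 2 : ℝ) : UnitAddCircle) := by
      rw [hω, fourier_apply, fourier_apply, ← Circle.coe_mul, ← toCircle_add, hδ, h2, hγ,
        ← coe_add, ← coe_zsmul, ← coe_zsmul, ← coe_add]
      congr 4
      simp only [zsmul_eq_mul]
      push_cast
      field_simp
      ring
    intro h
    rw [hωz, ← Circle.coe_one, Circle.coe_inj, ← toCircle_zero (T := 1)] at h
    obtain ⟨k, hk⟩ := (coe_eq_zero_iff (1 : ℝ)).1 (injective_toCircle one_ne_zero h)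
    have hk' : k * (q : ℤ) ^ 2 = n - m + 2 * n * q := by
      rw [zsmul_eq_mul, mul_one, eq_div_iff (by positivity)] at hk
      exact_mod_cast hk
    rw [← hk', abs_mul, abs_of_nonneg (by positivity : (0 : ℤ) ≤ (q : ℤ) ^ 2)] at hlt
    have hk1 : |k| < 1 := by
      by_contra hcon
      nlinarith [sq_nonneg (q : ℤ)]
    rw [Int.abs_lt_one_iff] at hk1
    exact h0 (by rw [← hk', hk1, zero_mul])
  have hinv := integral_add_right_eq_self (μ := haarAddCircle)
    (fun x => fourier (-m) x * fourier n (CircleAut.mixer q x)) γ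
  have hmul : (fun x => fourier (-m) (x + γ) * fourier n (CircleAut.mixer q (x + γ))) =
      fun x => ω * (fourier (-m) x * fourier n (CircleAut.mixer q x)) := by
    funext x
    rw [CircleAut.mixer_add_inv_sq, fourier_add_apply, fourier_add_apply, hω]
    ring
  rw [hmul, integral_const_mul] at hinv
  have := sub_eq_zero.2 hinv
  rw [← sub_one_mul] at this
  exact (mul_eq_zero.1 this).resolve_left (sub_ne_zero.2 hω1)

/-- The orthogonal projection onto the constants. -/
def meanProj : CircleL2 →L[ℂ] CircleL2 :=
  (innerSL ℂ (charL2 0)).smulRight (charL2 0)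

lemma meanProj_apply (f : CircleL2) : meanProj f = inner ℂ (charL2 0) f • charL2 0 := rfl

lemma inner_charL2 (m n : ℤ) : inner ℂ (charL2 m) (charL2 n) = if m = n then 1 else 0 :=
  orthonormal_iff_ite.1 orthonormal_fourier m n

lemma charL2_zero_koop (T : CircleAut) : T.koop (charL2 0) = charL2 0 := by
  refine Lp.ext ?_
  filter_upwards [koopman_charL2 T.measurePreserving 0, coeFn_fourierLp 2 0] with x h1 h2
  exact h1.trans (by rw [h2, fourier_zero, fourier_zero])

lemma tendsto_inner_mixer (f g : CircleL2) :
    Tendsto (fun r : ℕ => inner ℂ f ((CircleAut.mixer (r + 1)).koop g)) atTop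
      (𝓝 (inner ℂ f (meanProj g))) := by
  refine tendsto_inner_of_charL2 (fun r : ℕ => (CircleAut.mixer (r + 1)).koop) meanProj ?_ f g
  intro m n
  rw [meanProj_apply, inner_smul_right, inner_charL2, inner_charL2]
  refine tendsto_const_nhds.congr' ?_
  by_cases hn : n = 0
  · subst hn
    simp [charL2_zero_koop, inner_charL2]
  filter_upwards [eventually_ge_atTop (|n - m| + 2 * |n|).toNat] with r hr
  rw [if_neg (Ne.symm hn), zero_mul, inner_charL2_mixer]
  · intro h
    push_cast at h
    have h1 : |n - m| = 2 * |n| * (r + 1) := by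
      rw [show n - m = -(2 * n * (r + 1)) by linarith, abs_neg, abs_mul, abs_mul]
      simp
      left
      positivity
    have : 0 < |n| := abs_pos.2 hn
    have : |n - m| + 2 * |n| ≤ r := by simpa using hr
    nlinarith
  · push_cast
    have h1 : |n - m + 2 * n * (r + 1)| ≤ |n - m| + 2 * |n| * (r + 1) := by
      refine (abs_add_le _ _).trans (le_of_eq ?_)
      rw [abs_mul, abs_mul, abs_two, abs_of_nonneg (by positivity : (0 : ℤ) ≤ r + 1)]
    have : 0 ≤ |n - m| := abs_nonneg _
    have : |n - m| + 2 * |n| ≤ r := by simpa using hr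
    nlinarith

open Polynomial in
/-- A linear functional on polynomials with prescribed values on `1` and on polynomials that are
linearly independent modulo constants. -/
lemma exists_linearMap_polynomial {N : ℕ} (v : Fin N → ℤ[X])
    (hli : ∀ a : Fin N → ℤ, ∑ j, C (a j) * (v j - C ((v j).eval 0)) = 0 → a = 0)
    (α : ℚ) (γ : Fin N → ℚ) :
    ∃ g : ℚ[X] →ₗ[ℚ] ℚ, g 1 = α ∧ ∀ j, g ((v j).map (Int.castRingHom ℚ)) = γ j := by
  let w : Fin N → ℚ[X] := fun j => (v j - C ((v j).eval 0)).map (Int.castRingHom ℚ)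
  have hw : LinearIndependent ℚ w := by
    rw [← LinearIndependent.iff_fractionRing ℤ ℚ, Fintype.linearIndependent_iff]
    intro a ha
    refine congrFun (hli a ?_)
    refine map_injective (Int.castRingHom ℚ) Int.cast_injective ?_
    rw [Polynomial.map_sum, Polynomial.map_zero, ← ha]
    refine Finset.sum_congr rfl fun j _ => ?_
    simp [w, zsmul_eq_mul]
  obtain ⟨f, hf⟩ : ∃ f : ℚ[X] →ₗ[ℚ] ℚ, ∀ j, f (w j) = γ j - (v j).eval 0 * α := by
    obtain ⟨p, hp⟩ := (Fintype.linearCombination ℚ w).exists_leftInverse_of_injective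
      (LinearMap.ker_eq_bot.2 hw.fintypeLinearCombination_injective)
    refine ⟨Fintype.linearCombination ℚ (fun j => γ j - (v j).eval 0 * α) ∘ₗ p, fun j => ?_⟩
    have hj : p (w j) = Pi.single j 1 := by
      simpa using LinearMap.congr_fun hp (Pi.single j 1)
    simp [hj]
  refine ⟨f ∘ₗ (LinearMap.id - (monomial 0 : ℚ →ₗ[ℚ] ℚ[X]) ∘ₗ lcoeff ℚ 0) + α • lcoeff ℚ 0,
    ?_, fun j => ?_⟩
  · simp
  · have h : (v j).map (Int.castRingHom ℚ) - C (((v j).coeff 0 : ℤ) : ℚ) = w j := by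
      simp [w, coeff_zero_eq_eval_zero]
    have h' : ((v j).map (Int.castRingHom ℚ)).coeff 0 = ((v j).eval 0 : ℤ) := by
      simp [coeff_zero_eq_eval_zero]
    simp only [LinearMap.add_apply, LinearMap.comp_apply, LinearMap.sub_apply, LinearMap.id_apply,
      LinearMap.smul_apply, lcoeff_apply, h', smul_eq_mul, monomial_zero_left]
    rw [← coeff_zero_eq_eval_zero] at *
    rw [h, hf, coeff_zero_eq_eval_zero]
    ring

/-- Along multiples of a common denominator of `x`, the powers `n ^ l`, `l ≤ d`, multiply the
rational number `∑ x i / n ^ i` to something close to `x l` modulo `1`. -/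
lemma tendsto_pow_smul_sum_div {x : ℕ → ℚ} {d l : ℕ} (hl : l ≤ d) {n : ℕ → ℕ}
    (hn : Tendsto n atTop atTop) (hx : ∀ i ≤ d, ∀ k, (x i).den ∣ n k) :
    Tendsto (fun k => ((n k : ℤ) ^ l) •
        (((∑ i ∈ Finset.range (d + 1), x i / (n k : ℚ) ^ i : ℚ) : ℝ) : UnitAddCircle))
      atTop (𝓝 ((x l : ℝ) : UnitAddCircle)) := by
  have hreal : Tendsto (fun k => ∑ i ∈ Finset.range (d + 1),
      if l ≤ i then (x i : ℝ) / (n k : ℝ) ^ (i - l) else 0) atTop (𝓝 (x l)) := by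
    have : (x l : ℝ) = ∑ i ∈ Finset.range (d + 1), if i = l then (x i : ℝ) else 0 := by
      rw [Finset.sum_ite_eq' , if_pos (Finset.mem_range.2 (by omega))]
    rw [this]
    refine tendsto_finsetSum _ fun i _ => ?_
    rcases lt_trichotomy i l with h | rfl | h
    · simp [h.not_ge, h.ne]
    · simp
    · rw [if_neg h.ne']
      simp only [if_pos h.le]
      refine tendsto_const_nhds.div_atTop ?_
      exact (tendsto_pow_atTop (by omega)).comp (tendsto_natCast_atTop_atTop.comp hn)
  refine ((AddCircle.continuous_mk' (1 : ℝ)).tendsto _ |>.comp hreal).congr' ?_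
  filter_upwards [hn.eventually_ge_atTop 1] with k hk
  have hk0 : (n k : ℝ) ≠ 0 := by positivity
  rw [← coe_zsmul, Function.comp_apply]
  change ((_ : ℝ) : UnitAddCircle) = _
  push_cast
  rw [zsmul_eq_mul, Finset.mul_sum, ← sub_eq_zero, ← coe_sub, ← Finset.sum_sub_distrib]
  change QuotientAddGroup.mk' _ _ = _
  rw [map_sum]
  refine Finset.sum_eq_zero fun i hi => ?_
  refine (coe_eq_zero_iff (1 : ℝ)).2 ?_
  split_ifs with h
  · refine ⟨0, ?_⟩
    obtain ⟨m, rfl⟩ := Nat.exists_eq_add_of_le h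
    rw [Nat.add_sub_cancel_left, zero_smul]
    push_cast
    field_simp
    simp [pow_add, mul_comm]
  · obtain ⟨m, rfl⟩ := Nat.exists_eq_add_of_lt (not_le.1 h)
    obtain ⟨c, hc⟩ := hx i (by simpa [Nat.lt_succ_iff] using hi) k
    refine ⟨-((x i).num * c * (n k) ^ m), ?_⟩
    have hxi : (x i : ℝ) * (x i).den = (x i).num := by exact_mod_cast Rat.mul_den_eq_num (x i)
    have hxn : (x i : ℝ) * n k = (x i).num * c := by rw [hc, ← hxi]; push_cast; ring
    push_cast
    rw [zsmul_eq_mul]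
    push_cast
    rw [← hxn, pow_add, pow_add]
    field_simp
    ring

open Polynomial in
/-- Simultaneous approximation of prescribed rational rotations by polynomial multiples of
rational rotations. -/
lemma exists_tendsto_eval_smul {N : ℕ} (v : Fin N → ℤ[X])
    (hli : ∀ a : Fin N → ℤ, ∑ j, C (a j) * (v j - C ((v j).eval 0)) = 0 → a = 0)
    (α : ℚ) (γ : Fin N → ℚ) :
    ∃ (n : ℕ → ℕ) (a : ℕ → ℚ), Tendsto n atTop atTop ∧
      Tendsto (fun k => ((a k : ℝ) : UnitAddCircle)) atTop (𝓝 ((α : ℝ) : UnitAddCircle)) ∧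
      ∀ j, Tendsto (fun k => (v j).eval (n k : ℤ) • ((a k : ℝ) : UnitAddCircle)) atTop
        (𝓝 ((γ j : ℝ) : UnitAddCircle)) := by
  obtain ⟨g, hg1, hg⟩ := exists_linearMap_polynomial v hli α γ
  let x : ℕ → ℚ := fun l => g (X ^ l)
  let d : ℕ := Finset.univ.sup fun j => (v j).natDegree
  let D : ℕ := ∏ i ∈ Finset.range (d + 1), (x i).den
  let n : ℕ → ℕ := fun k => D * k
  have hD : 0 < D := Finset.prod_pos fun i _ => (x i).den_pos
  have hn : Tendsto n atTop atTop := tendsto_id.const_mul_atTop' hD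
  have hx : ∀ i ≤ d, ∀ k, (x i).den ∣ n k := fun i hi k =>
    (Finset.dvd_prod_of_mem (fun i => (x i).den) (Finset.mem_range.2 (by omega))).mul_right k
  refine ⟨n, fun k => ∑ i ∈ Finset.range (d + 1), x i / (n k : ℚ) ^ i, hn, ?_, fun j => ?_⟩
  · simpa [x, hg1] using tendsto_pow_smul_sum_div (Nat.zero_le d) hn hx
  · have hj : (v j).natDegree < d + 1 :=
      Nat.lt_succ_of_le (Finset.le_sup (f := fun j => (v j).natDegree) (Finset.mem_univ j))
    have hγ : ((γ j : ℝ) : UnitAddCircle) =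
        ∑ l ∈ Finset.range (d + 1), (v j).coeff l • ((x l : ℝ) : UnitAddCircle) := by
      have h : γ j = ∑ l ∈ Finset.range (d + 1), ((v j).coeff l : ℚ) * x l := by
        rw [← hg j]
        conv_lhs => rw [as_sum_range' (v j) (d + 1) hj]
        rw [Polynomial.map_sum, map_sum]
        refine Finset.sum_congr rfl fun l _ => ?_
        rw [map_monomial, ← smul_X_eq_monomial, map_smul]
        rfl
      rw [h]
      push_cast
      change QuotientAddGroup.mk' _ _ = _
      rw [map_sum]
      refine Finset.sum_congr rfl fun l _ => ?_
      rw [← zsmul_eq_mul]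
      rfl
    rw [hγ]
    simp only [eval_eq_sum_range' hj, Finset.sum_smul, mul_smul]
    refine tendsto_finsetSum _ fun l hl => ?_
    have := tendsto_pow_smul_sum_div (Nat.lt_succ_iff.1 (Finset.mem_range.1 hl)) hn hx
    exact ((continuous_zsmul ((v j).coeff l)).tendsto _).comp this

lemma inner_koop_meanProj (H : CircleAut) (f g : CircleL2) :
    inner ℂ (H.koop f) (meanProj (H.koop g)) = inner ℂ f (meanProj g) := by
  have h0 := charL2_zero_koop H
  rw [meanProj_apply, meanProj_apply, inner_smul_right, inner_smul_right]
  conv_lhs => rw [← h0]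
  rw [H.koop.inner_map_map, H.koop.inner_map_map]

namespace CircleAut

lemma inner_koop_conj (H S : CircleAut) (f g : CircleL2) :
    inner ℂ f ((H * S * H⁻¹).koop g) = inner ℂ (H.koop f) (S.koop (H.koop g)) := by
  rw [koop_mul, koop_mul, ← H.koop.inner_map_map, ← koop_mul, inv_mul_cancel, koop_one]

/-- The transformations conjugate to a rational rotation. -/
def rationalConj : Set CircleAut :=
  {T | ∃ (H : CircleAut) (α : ℚ), T = H * rot ((α : ℝ) : UnitAddCircle) * H⁻¹}

/-- The limit of the operators `T ^ v (n k)` along a rigid, respectively mixing, polynomial. -/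
def limitOp (rigid : Prop) [Decidable rigid] : CircleL2 →L[ℂ] CircleL2 :=
  if rigid then .id ℂ CircleL2 else meanProj

variable {N : ℕ}

/-- The transformations for which all `v j`, evaluated at a common `n ≥ m`, are nearly rigid or
nearly mixing as prescribed, with an accuracy depending on `m`. -/
def approxSet (v : Fin N → Polynomial ℤ) (t m : ℕ) : Set CircleAut :=
  {T | ∃ n : ℕ, m ≤ n ∧ ∀ k ∈ Set.Icc (-m : ℤ) m, ∀ l ∈ Set.Icc (-m : ℤ) m, ∀ j : Fin N,
    ‖inner ℂ (charL2 k) ((T ^ (v j).eval (n : ℤ)).koop (charL2 l)) -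
      inner ℂ (charL2 k) (limitOp (j < t) (charL2 l))‖ < 1 / ((m : ℝ) + 1)}

lemma isOpen_approxSet (v : Fin N → Polynomial ℤ) (t m : ℕ) : IsOpen (approxSet v t m) := by
  simp only [approxSet, Set.ofPred_exists, Set.ofPred_and, Set.ofPred_forall]
  refine isOpen_iUnion fun n => isOpen_const.inter ?_
  refine (Set.finite_Icc _ _).isOpen_biInter fun k _ => ?_
  refine (Set.finite_Icc _ _).isOpen_biInter fun l _ => isOpen_iInter_of_finite fun j => ?_
  refine isOpen_lt ?_ continuous_const
  exact ((continuous_const.inner (continuous_koop_zpow _ _)).sub continuous_const).norm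

lemma exists_mixer_approx (H : CircleAut) {p : ℕ} (hp : 0 < p) (m : ℕ) {ε : ℝ} (hε : 0 < ε) :
    ∃ r : ℕ, p ∣ r + 1 ∧ ∀ k ∈ Set.Icc (-m : ℤ) m, ∀ l ∈ Set.Icc (-m : ℤ) m,
      ‖inner ℂ (charL2 k) ((H * mixer (r + 1) * H⁻¹).koop (charL2 l)) -
        inner ℂ (charL2 k) (meanProj (charL2 l))‖ < ε := by
  have h : ∀ᶠ r : ℕ in atTop, ∀ k ∈ Set.Icc (-m : ℤ) m, ∀ l ∈ Set.Icc (-m : ℤ) m,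
      ‖inner ℂ (charL2 k) ((H * mixer (r + 1) * H⁻¹).koop (charL2 l)) -
        inner ℂ (charL2 k) (meanProj (charL2 l))‖ < ε := by
    refine (eventually_all_finite (Set.finite_Icc _ _)).2 fun k _ => ?_
    refine (eventually_all_finite (Set.finite_Icc _ _)).2 fun l _ => ?_
    rw [← inner_koop_meanProj H]
    simp only [inner_koop_conj, ← dist_eq_norm]
    exact Metric.tendsto_nhds.1 (tendsto_inner_mixer _ _) ε hε
  obtain ⟨R, hR⟩ := eventually_atTop.1 h
  refine ⟨p * (R + 1) - 1, ?_, hR _ ?_⟩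
  · rw [Nat.sub_add_cancel (Nat.mul_pos hp R.succ_pos)]
    exact dvd_mul_right _ _
  · exact Nat.le_sub_one_of_lt (Nat.le_mul_of_pos_left (R + 1) hp)

lemma rationalConj_subset_closure (v : Fin N → Polynomial ℤ)
    (hli : ∀ a : Fin N → ℤ,
      ∑ j, Polynomial.C (a j) * (v j - Polynomial.C ((v j).eval 0)) = 0 → a = 0) (t m : ℕ) :
    rationalConj ⊆ closure (rationalConj ∩ approxSet v t m) := by
  rintro _ ⟨H, α, rfl⟩
  obtain ⟨r, hr, hmix⟩ := exists_mixer_approx H α.den_pos m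
    (ε := 1 / ((m : ℝ) + 1)) (by positivity)
  have hα : (r + 1) • ((α : ℝ) : UnitAddCircle) = 0 := by
    obtain ⟨c, hc⟩ := hr
    rw [hc, mul_comm, mul_smul, ← coe_nsmul]
    have : α.den • (α : ℝ) = α.num • (1 : ℝ) := by
      rw [nsmul_eq_mul, zsmul_eq_mul, mul_one, mul_comm]
      exact_mod_cast Rat.mul_den_eq_num α
    rw [(coe_eq_zero_iff (1 : ℝ)).2 ⟨α.num, this.symm⟩, smul_zero]
  set K : CircleAut := H * shear (r + 1) with hK
  have hKconj (a : UnitAddCircle) :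
      K * rot a * K⁻¹ = H * (shear (r + 1) * rot a * (shear (r + 1))⁻¹) * H⁻¹ := by
    rw [hK]; group
  have hcont : Continuous fun a : UnitAddCircle => K * rot a * K⁻¹ :=
    (continuous_const.mul continuous_rot).mul continuous_const
  have hKα : K * rot ((α : ℝ) : UnitAddCircle) * K⁻¹ = H * rot ((α : ℝ) : UnitAddCircle) * H⁻¹ := by
    rw [hKconj, (commute_shear_rot (r + 1) hα).eq, mul_inv_cancel_right]
  obtain ⟨n, a, hn, ha, hv⟩ := exists_tendsto_eval_smul v hli α
    fun j => if (j : ℕ) < t then 0 else (((r + 1 : ℕ) : ℚ) ^ 2)⁻¹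
  rw [← hKα]
  refine mem_closure_of_tendsto ((hcont.tendsto _).comp ha) ?_
  suffices h : ∀ᶠ i in atTop, ∀ k ∈ Set.Icc (-m : ℤ) m, ∀ l ∈ Set.Icc (-m : ℤ) m, ∀ j : Fin N,
      ‖inner ℂ (charL2 k)
          (((K * rot ((a i : ℝ) : UnitAddCircle) * K⁻¹) ^ (v j).eval (n i : ℤ)).koop (charL2 l)) -
        inner ℂ (charL2 k) (limitOp (j < t) (charL2 l))‖ < 1 / ((m : ℝ) + 1) by
    filter_upwards [h, hn.eventually_ge_atTop m] with i hi hmi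
    exact ⟨⟨K, a i, rfl⟩, n i, hmi, hi⟩
  refine (eventually_all_finite (Set.finite_Icc _ _)).2 fun k hk => ?_
  refine (eventually_all_finite (Set.finite_Icc _ _)).2 fun l hl => eventually_all.2 fun j => ?_
  simp only [conj_zpow, ← rot_zsmul]
  have hlim := tendsto_koop ((hcont.tendsto _).comp (hv j)) (charL2 l)
  refine (((tendsto_const_nhds (x := charL2 k)).inner hlim).sub
    tendsto_const_nhds).norm.eventually_lt_const ?_
  by_cases hj : (j : ℕ) < t
  · simp only [if_pos hj, limitOp, Rat.cast_zero, coe_zero, rot_zero, mul_one, mul_inv_cancel,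
      koop_one]
    simp
    positivity
  · simp only [if_neg hj, limitOp, hKconj]
    have := hmix k hk l hl
    rw [mixer] at this
    simpa using this

/-- The generic transformation in the closure of the conjugates of rational rotations is rigid
along the first `t` polynomials and mixing along the others. -/
lemma exists_tendsto_inner_koop (v : Fin N → Polynomial ℤ)
    (hli : ∀ a : Fin N → ℤ,
      ∑ j, Polynomial.C (a j) * (v j - Polynomial.C ((v j).eval 0)) = 0 → a = 0) (t : ℕ) :
    ∃ (T : CircleAut) (n : ℕ → ℕ), StrictMono n ∧ ∀ (j : Fin N) (f g : CircleL2),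
      Tendsto (fun k => inner ℂ f ((T ^ (v j).eval (n k : ℤ)).koop g)) atTop
        (𝓝 (inner ℂ f (limitOp (j < t) g))) := by
  let X := closure rationalConj
  have : CompleteSpace X := isClosed_closure.completeSpace_coe
  have : Nonempty X := ⟨1, subset_closure ⟨1, 0, by simp [rot_zero]⟩⟩
  have hdense (m : ℕ) : Dense ((↑) ⁻¹' approxSet v t m : Set X) := by
    rw [Subtype.dense_iff, Subtype.image_preimage_coe]
    refine closure_minimal ((rationalConj_subset_closure v hli t m).trans ?_) isClosed_closure
    exact closure_mono (Set.inter_subset_inter_left _ subset_closure)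
  obtain ⟨T, hT⟩ := (dense_iInter_of_isOpen_nat
    (fun m => (isOpen_approxSet v t m).preimage continuous_subtype_val) hdense).nonempty
  choose n hmn hn using fun m => Set.mem_iInter.1 hT m
  obtain ⟨φ, hφ, hnφ⟩ := strictMono_subseq_of_tendsto_atTop
    (tendsto_atTop_mono hmn tendsto_id)
  refine ⟨T, n ∘ φ, hnφ, fun j f g => ?_⟩
  refine tendsto_inner_of_charL2 (fun k => ((T : CircleAut) ^ (v j).eval (n (φ k) : ℤ)).koop)
    (limitOp (j < t)) (fun k l => ?_) f g
  suffices h : Tendsto (fun m => inner ℂ (charL2 k)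
      (((T : CircleAut) ^ (v j).eval (n m : ℤ)).koop (charL2 l))) atTop
      (𝓝 (inner ℂ (charL2 k) (limitOp (j < t) (charL2 l)))) from h.comp hφ.tendsto_atTop
  rw [tendsto_iff_norm_sub_tendsto_zero]
  refine squeeze_zero' (.of_forall fun _ => norm_nonneg _) ?_ tendsto_one_div_add_atTop_nhds_zero_nat
  filter_upwards [eventually_ge_atTop (max k.natAbs l.natAbs)] with m hm
  have hkl := max_le_iff.1 hm
  exact (hn m k ⟨by omega, by omega⟩ l ⟨by omega, by omega⟩ j).le

end CircleAut

/-- The indicator function of a measurable subset of the circle. -/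
def indL2 {A : Set UnitAddCircle} (hA : MeasurableSet A) : CircleL2 :=
  indicatorConstLp 2 hA (measure_ne_top _ A) 1

lemma inner_indL2 {A B : Set UnitAddCircle} (hA : MeasurableSet A) (hB : MeasurableSet B) :
    inner ℂ (indL2 hA) (indL2 hB) = (haarAddCircle.real (A ∩ B) : ℂ) :=
  L2.inner_indicatorConstLp_one_indicatorConstLp_one hA hB

lemma koop_indL2 (T : CircleAut) {B : Set UnitAddCircle} (hB : MeasurableSet B) :
    T.koop (indL2 hB) = indL2 (T.measurePreserving.measurable hB) :=
  Lp.indicatorConstLp_compMeasurePreserving hB (measure_ne_top _ B) 1 T.measurePreserving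

lemma charL2_zero_eq_indL2 : charL2 0 = indL2 MeasurableSet.univ := by
  refine Lp.ext ?_
  filter_upwards [coeFn_fourierLp 2 0, indicatorConstLp_coeFn (p := 2) (hs := MeasurableSet.univ)
    (hμs := measure_ne_top (haarAddCircle (T := 1)) Set.univ) (c := (1 : ℂ))] with x h1 h2
  rw [h1, fourier_zero, indL2, h2, Set.indicator_univ]

lemma tendsto_measure_inter_preimage {N t : ℕ} {v : Fin N → Polynomial ℤ} {T : CircleAut}
    {n : ℕ → ℕ} {j : Fin N}
    (h : ∀ f g : CircleL2, Tendsto (fun k => inner ℂ f ((T ^ (v j).eval (n k : ℤ)).koop g)) atTop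
      (𝓝 (inner ℂ f (CircleAut.limitOp (j < t) g))))
    {A B : Set UnitAddCircle} (hA : MeasurableSet A) (hB : MeasurableSet B) :
    Tendsto (fun k => haarAddCircle.real (A ∩ (T ^ (v j).eval (n k : ℤ) : CircleAut) ⁻¹' B)) atTop
      (𝓝 (if (j : ℕ) < t then haarAddCircle.real (A ∩ B)
        else haarAddCircle.real A * haarAddCircle.real B)) := by
  have h1 := (Complex.continuous_re.tendsto _).comp (h (indL2 hA) (indL2 hB))
  simp only [Function.comp_def, koop_indL2, inner_indL2, Complex.ofReal_re] at h1
  convert h1 using 2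
  by_cases hj : (j : ℕ) < t
  · simp [CircleAut.limitOp, hj, inner_indL2]
  · rw [CircleAut.limitOp, if_neg hj, if_neg hj, meanProj_apply, inner_smul_right,
      charL2_zero_eq_indL2, inner_indL2, inner_indL2, Set.inter_univ, Set.univ_inter,
      ← Complex.ofReal_mul, Complex.ofReal_re, mul_comm]

/-- The circle is in bijection with the unit interval without its right endpoint. -/
def circleEquiv : UnitAddCircle ≃ {x : unitInterval // x ≠ 1} where
  toFun y := ⟨⟨equivIco 1 0 y, (equivIco 1 0 y).2.1, by simpa using (equivIco 1 0 y).2.2.le⟩,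
    fun h => by
      have h1 : ((equivIco (1 : ℝ) 0 y : ℝ)) = 1 := congrArg Subtype.val h
      simpa [h1] using (equivIco (1 : ℝ) 0 y).2.2.ne⟩
  invFun x := ((x : ℝ) : UnitAddCircle)
  left_inv y := coe_equivIco
  right_inv x := by
    refine Subtype.ext (Subtype.ext (equivIco_coe_of_mem ⟨x.1.2.1, ?_⟩))
    simpa using lt_of_le_of_ne x.1.2.2 fun h => x.2 (Subtype.ext h)

/-- The section of the quotient map from the unit interval to the circle. -/
def circleSection (y : UnitAddCircle) : unitInterval := circleEquiv y

lemma measurable_circleSection : Measurable circleSection := by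
  refine Measurable.subtype_mk ?_
  exact measurable_subtype_coe.comp (measurableEquivIco 1 0).measurable

lemma measurePreserving_unitInterval_mk :
    MeasurePreserving (fun x : unitInterval => ((x : ℝ) : UnitAddCircle)) volume haarAddCircle := by
  have h1 := UnitAddCircle.measurePreserving_mk 0
  rw [volume_eq_smul_haarAddCircle, ENNReal.ofReal_one, one_smul, zero_add,
    restrict_Ioc_eq_restrict_Icc] at h1
  exact h1.comp unitInterval.measurePreserving_coe

lemma circleSection_mk {x : unitInterval} (hx : x ≠ 1) :
    circleSection ((x : ℝ) : UnitAddCircle) = x :=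
  congrArg Subtype.val (circleEquiv.apply_symm_apply ⟨x, hx⟩)

lemma ae_ne_one : ∀ᵐ x : unitInterval, x ≠ 1 := by
  simp [ae_iff]

lemma measurePreserving_circleSection :
    MeasurePreserving circleSection haarAddCircle volume := by
  refine ⟨measurable_circleSection, ?_⟩
  rw [← measurePreserving_unitInterval_mk.map_eq,
    Measure.map_map measurable_circleSection measurePreserving_unitInterval_mk.measurable]
  refine (Measure.map_congr ?_).trans Measure.map_id
  filter_upwards [ae_ne_one] with x hx using circleSection_mk hx

namespace CircleAut

lemma measurePreserving_extendDomain (T : CircleAut) :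
    MeasurePreserving (T.1.extendDomain circleEquiv) (volume : Measure unitInterval) volume := by
  have hF : MeasurePreserving (fun x : unitInterval => circleSection (T ((x : ℝ) : UnitAddCircle)))
      volume volume :=
    measurePreserving_circleSection.comp (T.measurePreserving.comp measurePreserving_unitInterval_mk)
  have heq (x : unitInterval) (hx : x ≠ 1) :
      T.1.extendDomain circleEquiv x = circleSection (T ((x : ℝ) : UnitAddCircle)) :=
    T.1.extendDomain_apply_subtype circleEquiv hx
  refine ⟨?_, ?_⟩
  · refine measurable_of_restrict_of_restrict_compl (measurableSet_singleton 1) ?_ ?_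
    · exact measurable_of_countable _
    · convert hF.measurable.comp measurable_subtype_coe using 1
      funext x
      exact heq x x.2
  · refine (Measure.map_congr ?_).trans hF.map_eq
    filter_upwards [ae_ne_one] with x hx using heq x hx

/-- The transformation of the unit interval induced by a transformation of the circle. -/
def toAut01 (T : CircleAut) : Aut01 where
  toEquiv := T.1.extendDomain circleEquiv
  measurePreserving_toFun := T.measurePreserving_extendDomain
  measurePreserving_invFun := T⁻¹.measurePreserving_extendDomain

lemma corr_toAut01 (T : CircleAut) (m : ℤ) {A B : Set unitInterval} (hA : MeasurableSet A)
    (hB : MeasurableSet B) :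
    T.toAut01.corr m A B =
      haarAddCircle.real ((circleSection ⁻¹' A) ∩ (T ^ m : CircleAut) ⁻¹' (circleSection ⁻¹' B)) := by
  have hpow : (T.toAut01.toEquiv ^ m : Equiv.Perm unitInterval) =
      (T ^ m : CircleAut).1.extendDomain circleEquiv :=
    (T.1.extendDomain_zpow circleEquiv m).symm
  rw [Aut01.corr, hpow, ← measurePreserving_circleSection.measure_preimage
    (hA.inter ((T ^ m).measurePreserving_extendDomain.measurable hB)).nullMeasurableSet]
  congr 2
  ext y
  simp only [Set.mem_inter_iff, Set.mem_preimage, circleSection,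
    Equiv.Perm.extendDomain_apply_image]

end CircleAut

end CircleAutomorphisms

/-- Let `t ∈ {0,…,N}` and let `v_1,…,v_N ∈ ℤ[x]` be non-constant with
`v_1(x)-v_1(0),…,v_N(x)-v_N(0)` ℚ-linearly independent. Then there exist a strictly
increasing `(n_k)` in ℕ and `T ∈ Aut([0,1],ℬ,μ)` such that for all measurable `A,B`
and each `j`, `μ(A ∩ T^{-v_j(n_k)}B) → μ(A∩B)` if `j ≤ t` and `→ μ(A)μ(B)` if
`t < j ≤ N` (here `j : Fin N` is the `(j+1)`-st index). -/
theorem stmt_5 (N : ℕ) (t : ℕ) (ht : t ≤ N)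
    (v : Fin N → Polynomial ℤ) (hnc : ∀ j, 0 < (v j).natDegree)
    (hli : ∀ a : Fin N → ℤ,
      ∑ j, Polynomial.C (a j) * (v j - Polynomial.C ((v j).eval 0)) = 0 → a = 0) :
    ∃ n : ℕ → ℕ, StrictMono n ∧
      ∃ T : Aut01,
        ∀ A B : Set unitInterval, MeasurableSet A → MeasurableSet B →
          ∀ j : Fin N,
            ((j : ℕ) < t →
              Tendsto (fun k => T.corr ((v j).eval ((n k : ℤ))) A B) atTop
                (𝓝 ((volume (A ∩ B)).toReal))) ∧
            (t ≤ (j : ℕ) →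
              Tendsto (fun k => T.corr ((v j).eval ((n k : ℤ))) A B) atTop
                (𝓝 ((volume A).toReal * (volume B).toReal))) := by
  obtain ⟨T, n, hn, hT⟩ := CircleAut.exists_tendsto_inner_koop v hli t
  refine ⟨n, hn, T.toAut01, fun A B hA hB j => ?_⟩
  have hσ := measurePreserving_circleSection
  have h := tendsto_measure_inter_preimage (hT j) (hσ.measurable hA) (hσ.measurable hB)
  simp only [Measure.real, ← Set.preimage_inter,
    hσ.measure_preimage hA.nullMeasurableSet, hσ.measure_preimage hB.nullMeasurableSet,
    hσ.measure_preimage (hA.inter hB).nullMeasurableSet] at h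
  simp only [CircleAut.corr_toAut01 T _ hA hB, Measure.real]
  exact ⟨fun hj => by simpa only [if_pos hj] using h,
    fun hj => by simpa only [if_neg (not_lt.2 hj)] using h⟩
end
end

section
/- Let N ∈ ℕ, let (m_k)_{k∈ℕ} be a strictly increasing sequence in ℕ with k! dividing m_k for each k ∈ ℕ, and let v_1, …, v_N ∈ ℤ[x] be non-constant, ℚ-linearly independent polynomials with v_j(0) = 0 for each j ∈ {1,…,N}. Then there exists a subsequence (n_k)_{k∈ℕ} of (m_k)_{k∈ℕ} such that for every ξ = (ξ_1,…,ξ_N) ∈ {0,1}^N there exists a weakly mixing T_ξ ∈ Aut([0,1], ℬ, μ) with the property that for each j ∈ {1,…,N} and all measurable A, B ⊆ [0,1], lim_{k→∞} μ(A ∩ T_ξ^{−v_j(n_k)} B) = (1 − ξ_j) μ(A ∩ B) + ξ_j μ(A) μ(B). -/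
open MeasureTheory Filter Topology

noncomputable section

namespace Aut01

open ProbabilityTheory

/-- The character `x ↦ exp (i ∑ tₙ xₙ)` of `ℤ → ℝ` attached to a finitely supported `t`. -/
def expLin (t : ℤ →₀ ℝ) (x : ℤ → ℝ) : ℂ :=
  Complex.exp ((Finsupp.linearCombination ℝ x t : ℝ) * Complex.I)

lemma measurable_linearCombination {ι : Type*} (t : ι →₀ ℝ) :
    Measurable fun x : ι → ℝ => Finsupp.linearCombination ℝ x t := by
  simp only [Finsupp.linearCombination_apply, Finsupp.sum, smul_eq_mul]
  fun_prop

lemma measurable_expLin (t : ℤ →₀ ℝ) : Measurable (expLin t) := by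
  have := measurable_linearCombination t
  unfold expLin
  fun_prop

lemma norm_expLin (t : ℤ →₀ ℝ) (x : ℤ → ℝ) : ‖expLin t x‖ = 1 :=
  Complex.norm_exp_ofReal_mul_I _

lemma expLin_add (s t : ℤ →₀ ℝ) (x : ℤ → ℝ) : expLin (s + t) x = expLin s x * expLin t x := by
  simp [expLin, map_add, add_mul, Complex.exp_add]

lemma conj_expLin (t : ℤ →₀ ℝ) (x : ℤ → ℝ) :
    (starRingEnd ℂ) (expLin t x) = expLin (-t) x := by
  simp [expLin, ← Complex.exp_conj]

lemma integral_exp_linearCombination_infinitePi (v : ℕ → NNReal) (l : ℕ →₀ ℝ) :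
    ∫ g, Complex.exp ((Finsupp.linearCombination ℝ g l : ℝ) * Complex.I)
        ∂(Measure.infinitePi fun i => gaussianReal 0 (v i)) =
      Complex.exp (-((∑ i ∈ l.support, l i ^ 2 * v i : ℝ) : ℂ) / 2) := by
  have h1 : iIndepFun (fun (i : ℕ) (g : ℕ → ℝ) => l i * g i)
      (Measure.infinitePi fun i => gaussianReal 0 (v i)) :=
    iIndepFun_infinitePi (P := fun i => gaussianReal 0 (v i)) (X := fun i x => l i * x)
      fun i => by fun_prop
  have h2 := iIndepFun.charFun_map_fun_finsetSum_eq_prod (s := l.support)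
    (X := fun (i : ℕ) (g : ℕ → ℝ) => l i * g i)
    (P := Measure.infinitePi fun i => gaussianReal 0 (v i))
    (fun i _ => Measurable.aemeasurable (by fun_prop)) (h1.precomp (g := ((↑) : l.support → ℕ)) Subtype.val_injective)
  have h3 := congrFun h2 1
  rw [charFun_apply_real, integral_map (Measurable.aemeasurable (by fun_prop))
    (by fun_prop)] at h3
  have h4 : ∀ i, charFun ((Measure.infinitePi fun i => gaussianReal 0 (v i)).map
      fun g : ℕ → ℝ => l i * g i) 1 = Complex.exp (-((l i ^ 2 * v i : ℝ) : ℂ) / 2) := by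
    intro i
    have : (fun g : ℕ → ℝ => l i * g i) = (fun x : ℝ => l i * x) ∘ (fun g : ℕ → ℝ => g i) := rfl
    rw [this, ← Measure.map_map (by fun_prop) (by fun_prop),
      Measure.infinitePi_map_eval (fun i => gaussianReal 0 (v i)), charFun_map_mul,
      charFun_gaussianReal]
    congr 1
    push_cast
    ring
  simp only [Finset.prod_apply, h4, ← Complex.exp_sum] at h3
  simp only [Finsupp.linearCombination_apply, Finsupp.sum, smul_eq_mul]
  simp only [Complex.ofReal_one, one_mul] at h3
  rw [h3]
  congr 1
  push_cast
  rw [neg_div, Finset.sum_div, ← Finset.sum_neg_distrib]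
  exact Finset.sum_congr rfl fun i _ => by ring

lemma norm_sq_linearCombination_of_orthogonal {H : Type*} [NormedAddCommGroup H]
    [InnerProductSpace ℝ H] (w : ℕ → H) (hw : Pairwise fun i j => inner ℝ (w i) (w j) = 0)
    (l : ℕ →₀ ℝ) :
    ‖Finsupp.linearCombination ℝ w l‖ ^ 2 = ∑ i ∈ l.support, l i ^ 2 * ‖w i‖ ^ 2 := by
  rw [← real_inner_self_eq_norm_sq, Finsupp.linearCombination_apply, Finsupp.sum, sum_inner]
  refine Finset.sum_congr rfl fun i hi => ?_
  rw [inner_sum, Finset.sum_eq_single_of_mem i hi]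
  · rw [inner_smul_left, inner_smul_right, real_inner_self_eq_norm_sq]
    simp only [conj_trivial]
    ring
  · intro j _ hj
    rw [inner_smul_left, inner_smul_right, hw hj.symm]
    simp

/-- Any sequence of vectors in a real inner product space is the covariance structure of a centred
Gaussian measure on `ℤ → ℝ`. -/
theorem exists_gaussian_measure {H : Type*} [NormedAddCommGroup H] [InnerProductSpace ℝ H]
    (e : ℤ → H) :
    ∃ ν : Measure (ℤ → ℝ), IsProbabilityMeasure ν ∧ ∀ t : ℤ →₀ ℝ,
      ∫ x, expLin t x ∂ν =
        Complex.exp (-((‖Finsupp.linearCombination ℝ e t‖ ^ 2 : ℝ) : ℂ) / 2) := by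
  obtain ⟨q⟩ : Nonempty (ℕ ≃ ℤ) := ⟨Equiv.intEquivNat.symm⟩
  set w : ℕ → H := InnerProductSpace.gramSchmidt ℝ (e ∘ q) with hw
  have hspan : ∀ z, ∃ l : ℕ →₀ ℝ, Finsupp.linearCombination ℝ w l = e z := by
    intro z
    have h : e z ∈ Submodule.span ℝ (Set.range w) := by
      rw [hw, InnerProductSpace.span_gramSchmidt]
      exact Submodule.subset_span ⟨q.symm z, by simp⟩
    exact Finsupp.mem_span_range_iff_exists_finsupp.1 h
  choose L hL using hspan
  let P : Measure (ℕ → ℝ) := Measure.infinitePi fun i => gaussianReal 0 (‖w i‖₊ ^ 2)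
  let X : (ℕ → ℝ) → ℤ → ℝ := fun g z => Finsupp.linearCombination ℝ g (L z)
  have hX : Measurable X := measurable_pi_iff.2 fun z => measurable_linearCombination (L z)
  refine ⟨P.map X, Measure.isProbabilityMeasure_map hX.aemeasurable, fun t => ?_⟩
  rw [integral_map hX.aemeasurable (measurable_expLin t).aestronglyMeasurable]
  have h1 : ∀ g, Finsupp.linearCombination ℝ (X g) t =
      Finsupp.linearCombination ℝ g (Finsupp.linearCombination ℝ L t) := fun g =>
    (Finsupp.apply_linearCombination ℝ (Finsupp.linearCombination ℝ g) L t).symm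
  have h2 : Finsupp.linearCombination ℝ e t =
      Finsupp.linearCombination ℝ w (Finsupp.linearCombination ℝ L t) := by
    rw [Finsupp.apply_linearCombination]
    congr 1
    congr 1
    exact (funext hL).symm
  simp only [expLin, h1, h2]
  rw [integral_exp_linearCombination_infinitePi, norm_sq_linearCombination_of_orthogonal w
    (fun i j hij => InnerProductSpace.gramSchmidt_orthogonal ℝ _ hij)]
  simp

/-- A finite measure on `ℤ → ℝ` is determined by its characteristic function. -/
theorem measure_ext_of_expLin (μ ν : Measure (ℤ → ℝ)) [IsFiniteMeasure μ] [IsFiniteMeasure ν]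
    (h : ∀ t, ∫ x, expLin t x ∂μ = ∫ x, expLin t x ∂ν) : μ = ν := by
  refine IsProjectiveLimit.unique (P := fun I => μ.map I.restrict) (fun I => rfl) fun I => ?_
  refine Measure.ext_of_charFunDual (funext fun F => ?_)
  have hF : ∀ x : ℤ → ℝ, F (I.restrict x) = Finsupp.linearCombination ℝ x
      (∑ i : I, Finsupp.single (i : ℤ) (F (Pi.single i 1))) := by
    intro x
    have hx : I.restrict x = ∑ i : I, x i • (Pi.single i 1 : I → ℝ) := by
      rw [← Finset.univ_sum_single (I.restrict x)]
      refine Finset.sum_congr rfl fun i _ => ?_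
      rw [← Pi.single_smul]
      simp
    conv_lhs => rw [hx]
    simp [map_sum, mul_comm]
  simp only [charFunDual_apply]
  rw [integral_map (by fun_prop) (by fun_prop), integral_map (by fun_prop) (by fun_prop)]
  simp only [hF]
  exact (h _).symm

/-- The averages of `f` over the finite sets `S k` tend to `0`. -/
def AvgTendsto (S : ℕ → Finset ℕ) (f : ℕ → ℝ) : Prop :=
  Tendsto (fun k => (1 / ((S k).card : ℝ)) * ∑ n ∈ S k, f n) atTop (𝓝 0)

namespace AvgTendsto

variable {S : ℕ → Finset ℕ} {f g : ℕ → ℝ}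

lemma add (hf : AvgTendsto S f) (hg : AvgTendsto S g) : AvgTendsto S fun n => f n + g n := by
  have := Tendsto.add hf hg
  simpa only [AvgTendsto, Finset.sum_add_distrib, mul_add, add_zero] using this

lemma const_mul (c : ℝ) (hf : AvgTendsto S f) : AvgTendsto S fun n => c * f n := by
  have := Tendsto.const_mul c hf
  simpa only [AvgTendsto, ← Finset.mul_sum, mul_left_comm c, mul_zero] using this

lemma zero : AvgTendsto S fun _ => 0 := by
  simp [AvgTendsto]

lemma sum {ι : Type*} (s : Finset ι) (F : ι → ℕ → ℝ) (h : ∀ i ∈ s, AvgTendsto S (F i)) :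
    AvgTendsto S fun n => ∑ i ∈ s, F i n := by
  classical
  induction s using Finset.induction_on with
  | empty => simpa using zero
  | insert i s hi ih =>
    simp only [Finset.sum_insert hi]
    exact (h i (Finset.mem_insert_self i s)).add
      (ih fun j hj => h j (Finset.mem_insert_of_mem hj))

lemma mono (hg : AvgTendsto S g) (h0 : ∀ n, 0 ≤ f n) (h : ∀ n, f n ≤ g n) : AvgTendsto S f := by
  refine squeeze_zero (fun k => ?_) (fun k => ?_) hg
  · exact mul_nonneg (by positivity) (Finset.sum_nonneg fun n _ => h0 n)
  · exact mul_le_mul_of_nonneg_left (Finset.sum_le_sum fun n _ => h n) (by positivity)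

lemma of_approx (h0 : ∀ n, 0 ≤ f n)
    (h : ∀ ε > 0, ∃ g, AvgTendsto S g ∧ ∀ n, f n ≤ g n + ε) : AvgTendsto S f := by
  refine Metric.tendsto_atTop.2 fun ε hε => ?_
  obtain ⟨g, hg, hfg⟩ := h (ε / 2) (by positivity)
  obtain ⟨K, hK⟩ := Metric.tendsto_atTop.1 hg (ε / 2) (by positivity)
  refine ⟨K, fun k hk => ?_⟩
  have h1 : 0 ≤ (1 / ((S k).card : ℝ)) * ∑ n ∈ S k, f n :=
    mul_nonneg (by positivity) (Finset.sum_nonneg fun n _ => h0 n)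
  have h2 := hK k hk
  rw [Real.dist_0_eq_abs] at h2 ⊢
  rw [abs_of_nonneg h1]
  have h3 : (1 / ((S k).card : ℝ)) * ∑ n ∈ S k, f n ≤
      (1 / ((S k).card : ℝ)) * ∑ n ∈ S k, (g n + ε / 2) :=
    mul_le_mul_of_nonneg_left (Finset.sum_le_sum fun n _ => hfg n) (by positivity)
  have h4 : (1 / ((S k).card : ℝ)) * ((S k).card * (ε / 2)) ≤ ε / 2 := by
    rcases Nat.eq_zero_or_pos (S k).card with h | h
    · simp only [h, Nat.cast_zero, zero_mul, mul_zero]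
      positivity
    · have : (0 : ℝ) < (S k).card := by exact_mod_cast h
      exact le_of_eq (by field_simp)
  rw [Finset.sum_add_distrib, mul_add, Finset.sum_const, nsmul_eq_mul] at h3
  linarith [le_abs_self ((1 / ((S k).card : ℝ)) * ∑ n ∈ S k, g n)]

/-- Vanishing of averages of uniformly bounded seminorms propagates from a spanning set. -/
theorem of_span {H : Type*} [NormedAddCommGroup H] [NormedSpace ℂ H] (φ : ℕ → H → ℝ) (C : ℝ)
    (h0 : ∀ n x, 0 ≤ φ n x) (hadd : ∀ n x y, φ n (x + y) ≤ φ n x + φ n y)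
    (hsmul : ∀ n (c : ℂ) x, φ n (c • x) = ‖c‖ * φ n x) (hle : ∀ n x, φ n x ≤ C * ‖x‖)
    {s : Set H} (hs : (Submodule.span ℂ s).topologicalClosure = ⊤)
    (h : ∀ x ∈ s, AvgTendsto S fun n => φ n x) (x : H) : AvgTendsto S fun n => φ n x := by
  have h1 : ∀ y ∈ Submodule.span ℂ s, AvgTendsto S fun n => φ n y := by
    intro y hy
    induction hy using Submodule.span_induction with
    | mem y hy => exact h y hy
    | zero =>
      have : ∀ n, φ n 0 = 0 := fun n => by simpa using hsmul n 0 0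
      simpa only [this] using zero
    | add y z _ _ hy hz => exact (hy.add hz).mono (fun n => h0 n _) fun n => hadd n y z
    | smul c y _ hy => simpa only [hsmul] using hy.const_mul ‖c‖
  refine of_approx (fun n => h0 n x) fun ε hε => ?_
  have hx : x ∈ closure (Submodule.span ℂ s : Set H) := by
    rw [← Submodule.topologicalClosure_coe, hs]
    trivial
  obtain ⟨y, hy, hxy⟩ := Metric.mem_closure_iff.1 hx (ε / (|C| + 1)) (by positivity)
  refine ⟨_, h1 y hy, fun n => ?_⟩
  have h2 := hadd n y (x - y)
  rw [add_sub_cancel] at h2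
  have h3 : C * ‖x - y‖ ≤ ε := by
    rw [dist_eq_norm, lt_div_iff₀ (by positivity)] at hxy
    nlinarith [le_abs_self C, norm_nonneg (x - y)]
  linarith [hle n (x - y)]

end AvgTendsto

lemma ae_eq_zero_of_integral_expLin (ν : Measure (ℤ → ℝ)) [IsFiniteMeasure ν] (u : (ℤ → ℝ) → ℝ)
    (hu : Integrable u ν) (h : ∀ t, ∫ x, (u x : ℂ) * expLin t x ∂ν = 0) : u =ᵐ[ν] 0 := by
  have hp : AEMeasurable (fun x => ENNReal.ofReal (u x)) ν := hu.1.aemeasurable.ennreal_ofReal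
  have hn : AEMeasurable (fun x => ENNReal.ofReal (-u x)) ν :=
    hu.1.aemeasurable.neg.ennreal_ofReal
  have h1 := isFiniteMeasure_withDensity_ofReal hu.2
  have h2 := isFiniteMeasure_withDensity_ofReal hu.neg.2
  have key : ν.withDensity (fun x => ENNReal.ofReal (u x)) =
      ν.withDensity (fun x => ENNReal.ofReal (-u x)) := by
    refine @measure_ext_of_expLin _ _ h1 h2 fun t => ?_
    rw [integral_withDensity_eq_integral_toReal_smul₀ hp (ae_of_all _ fun x => by simp),
      integral_withDensity_eq_integral_toReal_smul₀ hn (ae_of_all _ fun x => by simp),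
      ← sub_eq_zero, ← integral_sub, ← h t]
    · refine integral_congr_ae (ae_of_all _ fun x => ?_)
      rcases le_total 0 (u x) with hx | hx
      · simp [ENNReal.toReal_ofReal, ENNReal.ofReal_of_nonpos, hx]
      · simp [ENNReal.toReal_ofReal, ENNReal.ofReal_of_nonpos, hx]
    · exact hu.pos_part.smul_bdd 1 (measurable_expLin t).aestronglyMeasurable
        (ae_of_all _ fun x => (norm_expLin t x).le)
    · exact hu.neg.pos_part.smul_bdd 1 (measurable_expLin t).aestronglyMeasurable
        (ae_of_all _ fun x => (norm_expLin t x).le)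
  rw [withDensity_eq_iff hp hn hu.lintegral_lt_top.ne] at key
  filter_upwards [key] with x hx
  rcases le_total 0 (u x) with h0 | h0
  · rw [ENNReal.ofReal_of_nonpos (by linarith : -u x ≤ 0), ENNReal.ofReal_eq_zero] at hx
    exact le_antisymm hx h0
  · rw [ENNReal.ofReal_of_nonpos h0, eq_comm, ENNReal.ofReal_eq_zero] at hx
    simp only [Pi.zero_apply]
    linarith

lemma memLp_expLin (ν : Measure (ℤ → ℝ)) [IsFiniteMeasure ν] (t : ℤ →₀ ℝ) :
    MemLp (expLin t) 2 ν :=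
  MemLp.of_bound (measurable_expLin t).aestronglyMeasurable 1
    (ae_of_all _ fun x => (norm_expLin t x).le)

/-- The character `expLin t` as an element of `L²`. -/
def expLinLp (ν : Measure (ℤ → ℝ)) [IsFiniteMeasure ν] (t : ℤ →₀ ℝ) : Lp ℂ 2 ν :=
  (memLp_expLin ν t).toLp _

lemma inner_expLinLp (ν : Measure (ℤ → ℝ)) [IsFiniteMeasure ν] (t : ℤ →₀ ℝ) (g : Lp ℂ 2 ν) :
    inner ℂ (expLinLp ν t) g = ∫ x, g x * expLin (-t) x ∂ν := by
  rw [L2.inner_def]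
  refine integral_congr_ae ?_
  filter_upwards [(memLp_expLin ν t).coeFn_toLp] with x hx
  rw [expLinLp, hx, RCLike.inner_apply, conj_expLin]

theorem topologicalClosure_span_expLinLp (ν : Measure (ℤ → ℝ)) [IsFiniteMeasure ν] :
    (Submodule.span ℂ (Set.range (expLinLp ν))).topologicalClosure = ⊤ := by
  rw [Submodule.topologicalClosure_eq_top_iff, Submodule.eq_bot_iff]
  intro g hg
  have hi : Integrable g ν := (Lp.memLp g).integrable (by norm_num)
  have h1 : ∀ t, ∫ x, g x * expLin t x ∂ν = 0 := by
    intro t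
    have := (Submodule.mem_orthogonal _ g).1 hg (expLinLp ν (-t))
      (Submodule.subset_span ⟨_, rfl⟩)
    rwa [inner_expLinLp, neg_neg] at this
  have hig : ∀ t, Integrable (fun x => g x * expLin t x) ν := fun t =>
    hi.mul_bdd (c := 1) (measurable_expLin t).aestronglyMeasurable
        (ae_of_all _ fun x => (norm_expLin t x).le)
  have hi' : Integrable (fun x => starRingEnd ℂ (g x)) ν :=
    Complex.conjCLE.toContinuousLinearMap.integrable_comp hi
  have hig' : ∀ t, Integrable (fun x => starRingEnd ℂ (g x) * expLin t x) ν := fun t =>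
    hi'.mul_bdd (c := 1) (measurable_expLin t).aestronglyMeasurable
        (ae_of_all _ fun x => (norm_expLin t x).le)
  have h2 : ∀ t, ∫ x, starRingEnd ℂ (g x) * expLin t x ∂ν = 0 := by
    intro t
    rw [← map_zero (starRingEnd ℂ), ← h1 (-t), ← integral_conj]
    refine integral_congr_ae (ae_of_all _ fun x => ?_)
    simp [← conj_expLin]
  have hre : (fun x => (g x).re) =ᵐ[ν] 0 := by
    refine ae_eq_zero_of_integral_expLin ν _ hi.re fun t => ?_
    have : ∀ x, ((g x).re : ℂ) * expLin t x =
        (1 / 2) * (g x * expLin t x + starRingEnd ℂ (g x) * expLin t x) := by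
      intro x
      rw [← add_mul, Complex.add_conj]
      push_cast
      ring
    simp only [this]
    rw [integral_const_mul, integral_add (hig t) (hig' t), h1, h2]
    simp
  have him : (fun x => (g x).im) =ᵐ[ν] 0 := by
    refine ae_eq_zero_of_integral_expLin ν _ hi.im fun t => ?_
    have : ∀ x, ((g x).im : ℂ) * expLin t x =
        (1 / (2 * Complex.I)) * (g x * expLin t x - starRingEnd ℂ (g x) * expLin t x) := by
      intro x
      rw [← sub_mul, Complex.sub_conj]
      field_simp [Complex.I_ne_zero]
      push_cast
      ring
    simp only [this]
    rw [integral_const_mul, integral_sub (hig t) (hig' t), h1, h2]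
    simp
  rw [Lp.eq_zero_iff_ae_eq_zero]
  filter_upwards [hre, him] with x h3 h4
  exact Complex.ext h3 h4

lemma inner_linearCombination {H : Type*} [NormedAddCommGroup H] [InnerProductSpace ℝ H]
    (e e' : ℤ → H) (s t : ℤ →₀ ℝ) :
    inner ℝ (Finsupp.linearCombination ℝ e s) (Finsupp.linearCombination ℝ e' t) =
      ∑ i ∈ s.support, ∑ j ∈ t.support, s i * t j * inner ℝ (e i) (e' j) := by
  rw [Finsupp.linearCombination_apply, Finsupp.linearCombination_apply, Finsupp.sum, Finsupp.sum,
    sum_inner]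
  refine Finset.sum_congr rfl fun i _ => ?_
  rw [inner_sum]
  refine Finset.sum_congr rfl fun j _ => ?_
  rw [inner_smul_left, inner_smul_right]
  simp only [conj_trivial]
  ring

/-- The shift by `n` on `ℤ → ℝ`. -/
def shiftBy (n : ℤ) (x : ℤ → ℝ) : ℤ → ℝ := fun m => x (m + n)

lemma measurable_shiftBy (n : ℤ) : Measurable (shiftBy n) := by
  unfold shiftBy
  fun_prop

lemma expLin_shiftBy (n : ℤ) (t : ℤ →₀ ℝ) (x : ℤ → ℝ) :
    expLin t (shiftBy n x) = expLin (t.mapDomain (· + n)) x := by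
  simp only [expLin, Finsupp.linearCombination_mapDomain]
  rfl

lemma abs_exp_sub_exp_le {u v K : ℝ} (hu : u ≤ K) (hv : v ≤ K) :
    |Real.exp u - Real.exp v| ≤ Real.exp K * |u - v| := by
  have := Convex.norm_image_sub_le_of_norm_deriv_le (f := Real.exp) (s := Set.Iic K)
    (C := Real.exp K) (fun x _ => Real.differentiableAt_exp)
    (fun x hx => by simpa using hx) (convex_Iic K) hv hu
  simpa using this

section Gaussian

variable {H : Type*} [NormedAddCommGroup H] [InnerProductSpace ℝ H] {e : ℤ → H} {c : ℤ → ℝ}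
  {ν : Measure (ℤ → ℝ)} [IsProbabilityMeasure ν]

lemma norm_linearCombination_shift (hc : ∀ i j, inner ℝ (e i) (e j) = c (j - i)) (n : ℤ)
    (t : ℤ →₀ ℝ) : ‖Finsupp.linearCombination ℝ e (t.mapDomain (· + n))‖ =
      ‖Finsupp.linearCombination ℝ e t‖ := by
  rw [← sq_eq_sq₀ (norm_nonneg _) (norm_nonneg _), ← real_inner_self_eq_norm_sq,
    ← real_inner_self_eq_norm_sq, Finsupp.linearCombination_mapDomain, inner_linearCombination,
    inner_linearCombination]
  simp [hc]

lemma measurePreserving_shiftBy (hc : ∀ i j, inner ℝ (e i) (e j) = c (j - i))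
    (hν : ∀ t : ℤ →₀ ℝ, ∫ x, expLin t x ∂ν =
      Complex.exp (-((‖Finsupp.linearCombination ℝ e t‖ ^ 2 : ℝ) : ℂ) / 2)) (n : ℤ) :
    MeasurePreserving (shiftBy n) ν ν := by
  refine ⟨measurable_shiftBy n, ?_⟩
  have := Measure.isProbabilityMeasure_map (μ := ν) (measurable_shiftBy n).aemeasurable
  refine measure_ext_of_expLin _ _ fun t => ?_
  rw [integral_map (measurable_shiftBy n).aemeasurable (measurable_expLin t).aestronglyMeasurable]
  simp only [expLin_shiftBy]
  rw [hν, hν, norm_linearCombination_shift hc]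

lemma inner_expLinLp_expLinLp (hν : ∀ t : ℤ →₀ ℝ, ∫ x, expLin t x ∂ν =
      Complex.exp (-((‖Finsupp.linearCombination ℝ e t‖ ^ 2 : ℝ) : ℂ) / 2)) (s t : ℤ →₀ ℝ) :
    inner ℂ (expLinLp ν s) (expLinLp ν t) =
      ((Real.exp (-(‖Finsupp.linearCombination ℝ e s‖ ^ 2 +
        ‖Finsupp.linearCombination ℝ e t‖ ^ 2) / 2) *
        Real.exp (inner ℝ (Finsupp.linearCombination ℝ e s) (Finsupp.linearCombination ℝ e t)) :
          ℝ) : ℂ) := by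
  have h1 : inner ℂ (expLinLp ν s) (expLinLp ν t) = ∫ x, expLin (t - s) x ∂ν := by
    rw [inner_expLinLp]
    refine integral_congr_ae ?_
    filter_upwards [(memLp_expLin ν t).coeFn_toLp] with x hx
    rw [expLinLp, hx, sub_eq_add_neg, expLin_add]
  rw [h1, hν, map_sub, norm_sub_sq_real, ← Real.exp_add, Complex.ofReal_exp, real_inner_comm]
  congr 1
  push_cast
  ring

lemma avgTendsto_inner_expLinLp (hc : ∀ i j, inner ℝ (e i) (e j) = c (j - i))
    (hν : ∀ t : ℤ →₀ ℝ, ∫ x, expLin t x ∂ν =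
      Complex.exp (-((‖Finsupp.linearCombination ℝ e t‖ ^ 2 : ℝ) : ℂ) / 2))
    {S : ℕ → Finset ℕ} {a : ℕ → ℤ} {ζ : ℝ} (hζ : ζ = 0 ∨ ζ = 1)
    (hS : ∀ h, AvgTendsto S fun n => |c (a n + h) - ζ * c h|) (s t : ℤ →₀ ℝ) :
    AvgTendsto S fun n =>
      ‖inner ℂ (expLinLp ν s) (expLinLp ν (t.mapDomain (· + a n))) -
        (ζ * inner ℂ (expLinLp ν s) (expLinLp ν t) + (1 - ζ) *
          (inner ℂ (expLinLp ν s) (expLinLp ν 0) * inner ℂ (expLinLp ν 0) (expLinLp ν t)))‖ := by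
  set E := Finsupp.linearCombination ℝ e with hE
  have key : AvgTendsto S fun n => |inner ℝ (E s) (E (t.mapDomain (· + a n))) -
      ζ * inner ℝ (E s) (E t)| := by
    have h1 : AvgTendsto S fun n => ∑ i ∈ s.support, ∑ j ∈ t.support,
        |s i * t j| * |c (a n + (j - i)) - ζ * c (j - i)| :=
      AvgTendsto.sum _ _ fun i _ => AvgTendsto.sum _ _ fun j _ => (hS _).const_mul _
    refine h1.mono (fun n => abs_nonneg _) fun n => ?_
    rw [hE, Finsupp.linearCombination_mapDomain, inner_linearCombination, inner_linearCombination,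
      Finset.mul_sum, ← Finset.sum_sub_distrib]
    refine (Finset.abs_sum_le_sum_abs _ _).trans (Finset.sum_le_sum fun i _ => ?_)
    rw [Finset.mul_sum, ← Finset.sum_sub_distrib]
    refine (Finset.abs_sum_le_sum_abs _ _).trans (Finset.sum_le_sum fun j _ => ?_)
    rw [← abs_mul, Function.comp_apply, hc, hc]
    refine le_of_eq (congrArg _ ?_)
    rw [show j + a n - i = a n + (j - i) by ring]
    ring
  set K := ‖E s‖ * ‖E t‖ with hK
  set D := Real.exp (-(‖E s‖ ^ 2 + ‖E t‖ ^ 2) / 2) with hD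
  refine (key.const_mul (D * Real.exp K)).mono (fun n => norm_nonneg _) fun n => ?_
  have h2 : ∀ n, E (t.mapDomain (· + n)) = Finsupp.linearCombination ℝ e (t.mapDomain (· + n)) :=
    fun n => rfl
  have h3 : Real.exp (-(‖E s‖ ^ 2 + ‖E (t.mapDomain (· + a n))‖ ^ 2) / 2) = D := by
    rw [h2, norm_linearCombination_shift hc]
  have hK1 : inner ℝ (E s) (E (t.mapDomain (· + a n))) ≤ K := by
    refine (real_inner_le_norm _ _).trans (le_of_eq ?_)
    rw [h2, norm_linearCombination_shift hc]
  have hK2 : ζ * inner ℝ (E s) (E t) ≤ K := by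
    have := real_inner_le_norm (E s) (E t)
    have : 0 ≤ K := by positivity
    rcases hζ with rfl | rfl <;> simp <;> assumption
  have h4 : ζ * (D * Real.exp (inner ℝ (E s) (E t))) + (1 - ζ) *
      (Real.exp (-(‖E s‖ ^ 2 + ‖E 0‖ ^ 2) / 2) * Real.exp (inner ℝ (E s) (E 0)) *
        (Real.exp (-(‖E 0‖ ^ 2 + ‖E t‖ ^ 2) / 2) * Real.exp (inner ℝ (E 0) (E t)))) =
      D * Real.exp (ζ * inner ℝ (E s) (E t)) := by
    rcases hζ with rfl | rfl
    · simp only [map_zero, norm_zero, inner_zero_left, inner_zero_right, Real.exp_zero, hD]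
      rw [zero_mul, zero_add, zero_mul, Real.exp_zero, sub_zero, one_mul, mul_one, mul_one, mul_one,
        ← Real.exp_add]
      congr 1
      ring
    · simp
  simp only [inner_expLinLp_expLinLp hν]
  rw [← hE, h3, ← hD]
  have h5 := abs_exp_sub_exp_le hK1 hK2
  rw [mul_assoc]
  have hD0 : 0 ≤ D := (Real.exp_pos _).le
  refine le_trans (le_of_eq ?_) (mul_le_mul_of_nonneg_left h5 hD0)
  rw [← abs_of_nonneg hD0, ← abs_mul, abs_of_nonneg hD0, mul_sub, ← h4, ← Real.norm_eq_abs,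
    ← Complex.norm_real]
  congr 1
  push_cast
  ring

/-- Averaged rigidity (`ζ = 1`) and mixing (`ζ = 0`) of the covariance function of a stationary
Gaussian process pass to the shift on its path space. -/
theorem avgTendsto_measure_inter_shiftBy (hc : ∀ i j, inner ℝ (e i) (e j) = c (j - i))
    (hν : ∀ t : ℤ →₀ ℝ, ∫ x, expLin t x ∂ν =
      Complex.exp (-((‖Finsupp.linearCombination ℝ e t‖ ^ 2 : ℝ) : ℂ) / 2))
    {S : ℕ → Finset ℕ} {a : ℕ → ℤ} {ζ : ℝ} (hζ : ζ = 0 ∨ ζ = 1)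
    (hS : ∀ h, AvgTendsto S fun n => |c (a n + h) - ζ * c h|) {A B : Set (ℤ → ℝ)}
    (hA : MeasurableSet A) (hB : MeasurableSet B) :
    AvgTendsto S fun n => |ν.real (A ∩ shiftBy (a n) ⁻¹' B) -
      (ζ * ν.real (A ∩ B) + (1 - ζ) * (ν.real A * ν.real B))| := by
  let U : ℕ → Lp ℂ 2 ν →ₗᵢ[ℂ] Lp ℂ 2 ν := fun n =>
    Lp.compMeasurePreservingₗᵢ ℂ (shiftBy (a n)) (measurePreserving_shiftBy hc hν (a n))
  let z : Lp ℂ 2 ν := expLinLp ν 0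
  have hz : ‖z‖ ≤ 1 := by
    have h : inner ℂ z z = (1 : ℂ) := by
      rw [inner_expLinLp_expLinLp hν]
      simp
    have h' := norm_sq_eq_re_inner (𝕜 := ℂ) z
    rw [h] at h'
    rw [RCLike.one_re] at h'
    nlinarith [norm_nonneg z]
  let ψ : ℕ → Lp ℂ 2 ν → Lp ℂ 2 ν → ℂ := fun n x y =>
    inner ℂ x (U n y) - (ζ * inner ℂ x y + (1 - ζ) * (inner ℂ x z * inner ℂ z y))
  have hbd : ∀ n x y, ‖ψ n x y‖ ≤ 3 * ‖x‖ * ‖y‖ := by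
    intro n x y
    have h1 : ‖inner ℂ x (U n y)‖ ≤ ‖x‖ * ‖y‖ := by
      simpa using norm_inner_le_norm (𝕜 := ℂ) x (U n y)
    have h2 : ‖inner ℂ x y‖ ≤ ‖x‖ * ‖y‖ := norm_inner_le_norm (𝕜 := ℂ) x y
    have h3 : ‖inner ℂ x z * inner ℂ z y‖ ≤ ‖x‖ * ‖y‖ := by
      rw [norm_mul]
      refine mul_le_mul ((norm_inner_le_norm _ _).trans ?_) ((norm_inner_le_norm _ _).trans ?_)
        (norm_nonneg _) (norm_nonneg _)
      · exact mul_le_of_le_one_right (norm_nonneg _) hz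
      · exact mul_le_of_le_one_left (norm_nonneg _) hz
    have h4 : 0 ≤ ‖x‖ * ‖y‖ := by positivity
    refine (norm_sub_le _ _).trans ?_
    rcases hζ with rfl | rfl
    · simp only [Complex.ofReal_zero, zero_mul, zero_add, sub_zero, one_mul]
      linarith
    · simp only [Complex.ofReal_one, sub_self, zero_mul, add_zero, one_mul]
      linarith
  have hU : ∀ n t, U n (expLinLp ν t) = expLinLp ν (t.mapDomain (· + a n)) := by
    intro n t
    refine (Lp.toLp_compMeasurePreserving (memLp_expLin ν t)
      (measurePreserving_shiftBy hc hν (a n))).trans ?_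
    refine MemLp.toLp_congr _ _ (ae_of_all _ fun x => ?_)
    exact expLin_shiftBy _ _ _
  have step1 : ∀ s y, AvgTendsto S fun n => ‖ψ n (expLinLp ν s) y‖ := by
    intro s
    refine AvgTendsto.of_span (fun n y => ‖ψ n (expLinLp ν s) y‖) (3 * ‖expLinLp ν s‖)
      (fun n y => norm_nonneg _) (fun n y y' => ?_) (fun n r y => ?_) (fun n y => hbd n _ y)
      (topologicalClosure_span_expLinLp ν) ?_
    · refine le_trans (le_of_eq (congrArg _ ?_)) (norm_add_le _ _)
      simp only [ψ, map_add, inner_add_right]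
      ring
    · rw [← norm_mul]
      refine congrArg _ ?_
      simp only [ψ, map_smul, inner_smul_right]
      ring
    · rintro _ ⟨t, rfl⟩
      simpa only [ψ, hU] using avgTendsto_inner_expLinLp hc hν hζ hS s t
  have step2 : ∀ y x, AvgTendsto S fun n => ‖ψ n x y‖ := by
    intro y
    refine AvgTendsto.of_span (fun n x => ‖ψ n x y‖) (3 * ‖y‖)
      (fun n x => norm_nonneg _) (fun n x x' => ?_) (fun n r x => ?_) (fun n x => ?_)
      (topologicalClosure_span_expLinLp ν) ?_
    · refine le_trans (le_of_eq (congrArg _ ?_)) (norm_add_le _ _)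
      simp only [ψ, inner_add_left]
      ring
    · rw [← RCLike.norm_conj r, ← norm_mul]
      refine congrArg _ ?_
      simp only [ψ, inner_smul_left]
      ring
    · exact (hbd n x y).trans (le_of_eq (by ring))
    · rintro _ ⟨s, rfl⟩
      exact step1 s y
  have hfin : ∀ {A : Set (ℤ → ℝ)}, ν A ≠ ⊤ := fun {A} => measure_ne_top ν A
  have h1 : z = indicatorConstLp 2 MeasurableSet.univ hfin (1 : ℂ) := by
    refine MemLp.toLp_congr _ _ (ae_of_all _ fun x => ?_)
    simp [expLin]
  have h2 : ∀ n, U n (indicatorConstLp 2 hB hfin (1 : ℂ)) =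
      indicatorConstLp 2 (measurable_shiftBy (a n) hB) hfin (1 : ℂ) := by
    intro n
    exact Lp.indicatorConstLp_compMeasurePreserving hB hfin 1 (measurePreserving_shiftBy hc hν (a n))
  have h3 := step2 (indicatorConstLp 2 hB hfin 1) (indicatorConstLp 2 hA hfin 1)
  simp only [ψ, h2] at h3
  rw [h1] at h3
  simp only [L2.inner_indicatorConstLp_indicatorConstLp, Set.inter_univ, Set.univ_inter] at h3
  convert h3 using 3 with n
  rw [← Real.norm_eq_abs, ← Complex.norm_real]
  congr 1
  simp

end Gaussian

/-- The points at which a cumulative distribution function, evaluated to the right of `q`, has the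
same value as at `q` form a null set. -/
lemma measure_Ioi_inter_cdf_eq (ρ : Measure ℝ) [IsProbabilityMeasure ρ] [NullSingletonClass ρ] (q : ℝ) :
    ρ {x | q < x ∧ cdf ρ x = cdf ρ q} = 0 := by
  set N : Set ℝ := ⋃ p ∈ {p : ℚ | q < p ∧ cdf ρ p = cdf ρ q}, Set.Ioc q p
  have hN : ρ N = 0 := by
    refine (measure_biUnion_null_iff (Set.to_countable _)).2 fun p hp => ?_
    rw [← measure_cdf ρ, StieltjesFunction.measure_Ioc, hp.2, sub_self, ENNReal.ofReal_zero]
  have hsub : ({x | q < x ∧ cdf ρ x = cdf ρ q} \ N).Subsingleton := by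
    have aux : ∀ z w : ℝ, z ∉ N → q < z → cdf ρ w = cdf ρ q → z < w → False := by
      intro z w hz hqz hw hzw
      obtain ⟨p, hp1, hp2⟩ := exists_rat_btwn hzw
      refine hz (Set.mem_biUnion (x := p) ⟨hqz.trans hp1, le_antisymm ?_ ?_⟩ ⟨hqz, hp1.le⟩)
      · exact hw ▸ monotone_cdf ρ hp2.le
      · exact monotone_cdf ρ (hqz.trans hp1).le
    rintro z ⟨⟨hz1, hz2⟩, hz⟩ w ⟨⟨hw1, hw2⟩, hw⟩
    rcases lt_trichotomy z w with h | h | h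
    · exact (aux z w hz hz1 hw2 h).elim
    · exact h
    · exact (aux w z hw hw1 hz2 h).elim
  refine measure_mono_null (t := N ∪ ({x | q < x ∧ cdf ρ x = cdf ρ q} \ N)) ?_
    (measure_union_null hN (hsub.measure_zero ρ))
  rw [Set.union_sdiff_self]
  exact Set.subset_union_right

lemma continuous_cdf (ρ : Measure ℝ) [IsProbabilityMeasure ρ] [NullSingletonClass ρ] :
    Continuous (cdf ρ) := by
  refine continuous_iff_continuousAt.2 fun x => ?_
  rw [(monotone_cdf ρ).continuousAt_iff_leftLim_eq_rightLim, StieltjesFunction.rightLim_eq]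
  have h : ρ {x} = 0 := measure_singleton x
  rw [← measure_cdf ρ, StieltjesFunction.measure_singleton, ENNReal.ofReal_eq_zero] at h
  exact le_antisymm ((monotone_cdf ρ).leftLim_le le_rfl) (by linarith)

lemma measure_cdf_le (ρ : Measure ℝ) [IsProbabilityMeasure ρ] [NullSingletonClass ρ] {t : ℝ} (h0 : 0 ≤ t)
    (h1 : t ≤ 1) : ρ {x | cdf ρ x ≤ t} = ENNReal.ofReal t := by
  have key : ∀ t : ℝ, 0 < t → t < 1 → ρ {x | cdf ρ x ≤ t} = ENNReal.ofReal t := by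
    intro t h0 h1
    obtain ⟨x, rfl⟩ : ∃ x, cdf ρ x = t :=
      mem_range_of_exists_le_of_exists_ge (continuous_cdf ρ)
        (((tendsto_cdf_atBot ρ).eventually (gt_mem_nhds h0)).exists.imp fun _ h => h.le)
        (((tendsto_cdf_atTop ρ).eventually (lt_mem_nhds h1)).exists.imp fun _ h => h.le)
    rw [ofReal_cdf]
    refine le_antisymm ?_ (measure_mono fun y hy => monotone_cdf ρ hy)
    refine (measure_mono (t := Set.Iic x ∪ {y | x < y ∧ cdf ρ y = cdf ρ x}) fun y hy => ?_).trans
      ((measure_union_le _ _).trans (by rw [measure_Ioi_inter_cdf_eq, add_zero]))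
    rcases le_or_gt y x with h | h
    · exact Or.inl h
    · exact Or.inr ⟨h, le_antisymm hy (monotone_cdf ρ h.le)⟩
  rcases h1.eq_or_lt with rfl | h1
  · rw [ENNReal.ofReal_one, ← measure_univ (μ := ρ)]
    congr
    ext x
    simp [cdf_le_one]
  rcases h0.eq_or_lt with rfl | h0
  · rw [ENNReal.ofReal_zero, ← nonpos_iff_eq_zero]
    refine ENNReal.le_of_forall_pos_le_add fun ε hε _ => ?_
    have hε' : (0 : ℝ) < min ε (1 / 2) := lt_min (by exact_mod_cast hε) (by norm_num)
    have h2 : min (ε : ℝ) (1 / 2) < 1 := (min_le_right _ _).trans_lt (by norm_num)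
    rw [zero_add]
    refine (measure_mono fun x (hx : cdf ρ x ≤ 0) => hx.trans hε'.le).trans
      ((key _ hε' h2).le.trans ?_)
    refine (ENNReal.ofReal_le_ofReal (min_le_left _ _)).trans ?_
    simp
  · exact key t h0 h1

/-- Every atomless probability measure on a standard Borel space is mapped to the Lebesgue measure
of `[0,1]` by a map which is injective on a set of full measure. -/
theorem exists_measurePreserving_unitInterval {Y : Type*} [MeasurableSpace Y]
    [StandardBorelSpace Y] (ν : Measure Y) [IsProbabilityMeasure ν] [NullSingletonClass ν] :
    ∃ F : Y → unitInterval, MeasurePreserving F ν volume ∧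
      ∃ G : Set Y, MeasurableSet G ∧ ν Gᶜ = 0 ∧ Set.InjOn F G := by
  have hemb := measurableEmbedding_embeddingReal Y
  set ρ : Measure ℝ := ν.map (embeddingReal Y) with hρ
  have : IsProbabilityMeasure ρ := Measure.isProbabilityMeasure_map hemb.measurable.aemeasurable
  have : NullSingletonClass ρ := by
    refine ⟨fun x => ?_⟩
    rw [hρ, hemb.map_apply]
    exact (Set.subsingleton_singleton.preimage hemb.injective).measure_zero ν
  have hm : Measurable (cdf ρ) := (monotone_cdf ρ).measurable
  set F : ℝ → unitInterval := fun x => ⟨cdf ρ x, cdf_nonneg ρ x, cdf_le_one ρ x⟩ with hF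
  have hFm : Measurable F := hm.subtype_mk
  have hFp : MeasurePreserving F ρ volume := by
    refine ⟨hFm, ?_⟩
    have := Measure.isProbabilityMeasure_map (μ := ρ) hFm.aemeasurable
    refine Measure.ext_of_Iic _ _ fun t => ?_
    rw [Measure.map_apply hFm measurableSet_Iic, unitInterval.volume_Iic]
    exact measure_cdf_le ρ t.2.1 t.2.2
  set G : Set ℝ := ⋂ q : ℚ, {x | (q : ℝ) < x ∧ cdf ρ x = cdf ρ q}ᶜ with hG
  have hGm : MeasurableSet G := by
    refine MeasurableSet.iInter fun q => MeasurableSet.compl ?_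
    exact (measurableSet_Ioi (a := (q : ℝ))).inter (hm (measurableSet_singleton _))
  have hG0 : ρ Gᶜ = 0 := by
    rw [hG, Set.compl_iInter]
    refine measure_iUnion_null fun q => ?_
    rw [compl_compl]
    exact measure_Ioi_inter_cdf_eq ρ q
  refine ⟨F ∘ embeddingReal Y, hFp.comp ⟨hemb.measurable, rfl⟩, embeddingReal Y ⁻¹' G,
    hemb.measurable hGm, ?_, ?_⟩
  · rw [← Set.preimage_compl, ← hemb.map_apply]
    exact hG0
  · have aux : ∀ x y : ℝ, y ∈ G → F x = F y → x < y → False := by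
      intro x y hy hxy hlt
      obtain ⟨q, hq1, hq2⟩ := exists_rat_btwn hlt
      have hxy' : cdf ρ x = cdf ρ y := congrArg Subtype.val hxy
      refine Set.mem_iInter.1 hy q ⟨hq2, le_antisymm ?_ (monotone_cdf ρ hq2.le)⟩
      exact hxy' ▸ monotone_cdf ρ hq1.le
    intro x hx y hy hxy
    apply hemb.injective
    rcases lt_trichotomy (embeddingReal Y x) (embeddingReal Y y) with h | h | h
    · exact (aux _ _ hy hxy h).elim
    · exact h
    · exact (aux _ _ hx hxy.symm h).elim

/-- An invertible measure-preserving transformation of an atomless standard probability space is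
modelled by an element of `Aut01`. -/
theorem exists_corr_eq {Y : Type*} [MeasurableSpace Y] [StandardBorelSpace Y] (ν : Measure Y)
    [IsProbabilityMeasure ν] [NullSingletonClass ν] (T : Equiv.Perm Y)
    (hT : ∀ n : ℤ, MeasurePreserving (T ^ n : Equiv.Perm Y) ν ν) :
    ∃ S : Aut01, ∃ F : Y → unitInterval, MeasurePreserving F ν volume ∧
      ∀ (n : ℤ) (A B : Set unitInterval), MeasurableSet A → MeasurableSet B →
        S.corr n A B = ν.real (F ⁻¹' A ∩ (T ^ n : Equiv.Perm Y) ⁻¹' (F ⁻¹' B)) := by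
  classical
  obtain ⟨F, hF, G, hGm, hG0, hinj⟩ := exists_measurePreserving_unitInterval ν
  set Y0 : Set Y := ⋂ n : ℤ, (T ^ n : Equiv.Perm Y) ⁻¹' G with hY0
  have hY0m : MeasurableSet Y0 := MeasurableSet.iInter fun n => (hT n).measurable hGm
  have hae : ∀ᵐ y ∂ν, y ∈ Y0 := by
    rw [hY0]
    simp only [Set.mem_iInter]
    exact ae_all_iff.2 fun n => (hT n).quasiMeasurePreserving.ae (mem_ae_iff.2 hG0)
  have hsub : Y0 ⊆ G := fun y hy => by simpa using Set.mem_iInter.1 hy 0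
  have hinv : ∀ (n : ℤ) y, y ∈ Y0 ↔ (T ^ n : Equiv.Perm Y) y ∈ Y0 := by
    intro n y
    simp only [hY0, Set.mem_iInter, Set.mem_preimage, ← Equiv.Perm.mul_apply, ← zpow_add]
    exact (Equiv.addRight n).forall_congr_right (q := fun k => (T ^ k : Equiv.Perm Y) y ∈ G) |>.symm
  have := hY0m.standardBorel
  set F0 : Y0 → unitInterval := fun y => F y with hF0
  have hF0i : Function.Injective F0 := fun x y h => Subtype.ext (hinj (hsub x.2) (hsub y.2) h)
  have hF0e : MeasurableEmbedding F0 :=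
    (hF.measurable.comp measurable_subtype_coe).measurableEmbedding hF0i
  set f : Y0 ≃ Set.range F0 := Equiv.ofInjective F0 hF0i with hf
  let T0 : Equiv.Perm Y0 := T.subtypePerm fun y => by simpa using (hinv 1 y).symm
  have hT0 : ∀ (n : ℤ) (y : Y0), ((T0 ^ n) y : Y) = (T ^ n : Equiv.Perm Y) y := by
    intro n y
    rw [Equiv.Perm.subtypePerm_zpow]
    rfl
  let S : ℤ → Equiv.Perm unitInterval := fun n => (T0 ^ n).extendDomain f
  have hS : ∀ n, ∀ y ∈ Y0, S n (F y) = F ((T ^ n : Equiv.Perm Y) y) := by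
    intro n y hy
    have := (T0 ^ n).extendDomain_apply_image f ⟨y, hy⟩
    simpa [hf, hF0, S, hT0] using this
  have hSm : ∀ n, Measurable (S n) := by
    intro n B hB
    have hR : Measurable (T0 ^ n) := by
      have h1 : Measurable fun y => ((T0 ^ n) y : Y) := by
        simp only [hT0]
        exact (hT n).measurable.comp measurable_subtype_coe
      exact h1.subtype_mk (h := fun y => ((T0 ^ n) y).2)
    have : S n ⁻¹' B = F0 '' ((T0 ^ n) ⁻¹' (F0 ⁻¹' B)) ∪ (B \ Set.range F0) := by
      ext x
      by_cases hx : x ∈ Set.range F0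
      · obtain ⟨y, rfl⟩ := hx
        have h1 : S n (F0 y) = F0 ((T0 ^ n) y) := by
          rw [hF0]
          simp only [hT0]
          exact hS n y y.2
        simp [h1, hF0i.eq_iff]
      · have h1 : S n x = x := Equiv.Perm.extendDomain_apply_not_subtype _ _ hx
        have h2 : x ∉ F0 '' ((T0 ^ n) ⁻¹' (F0 ⁻¹' B)) := fun h => hx (Set.image_subset_range _ _ h)
        simp only [Set.mem_preimage, h1, Set.mem_union, h2, false_or, Set.mem_sdiff, hx,
          not_false_eq_true, and_true]
    rw [this]
    exact (hF0e.measurableSet_image.2 (hR (hF0e.measurable hB))).union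
      (hB.diff hF0e.measurableSet_range)
  have hSp : ∀ n, MeasurePreserving (S n) volume volume := by
    intro n
    refine ⟨hSm n, ?_⟩
    conv_lhs => rw [← hF.map_eq]
    rw [Measure.map_map (hSm n) hF.measurable, ← (hF.comp (hT n)).map_eq]
    exact Measure.map_congr (hae.mono fun y hy => hS n y hy)
  have hSn : ∀ n, S n = S 1 ^ n := fun n => by
    simp only [S, zpow_one, Equiv.Perm.extendDomain_zpow]
  refine ⟨⟨S 1, hSp 1, ?_⟩, F, hF, fun n A B hA hB => ?_⟩
  · have : (S 1).symm = S (-1) := by rw [hSn (-1), zpow_neg_one]; rfl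
    rw [this]
    exact hSp (-1)
  · simp only [corr]
    rw [← hSn, ← hF.measure_preimage (hA.inter (hSm n hB)).nullMeasurableSet, measureReal_def]
    congr 1
    refine measure_congr (hae.mono fun y hy => ?_)
    refine propext (and_congr Iff.rfl ?_)
    change S n (F y) ∈ B ↔ F _ ∈ B
    rw [hS n y hy]

/-- The shift on `ℤ → ℝ` as a permutation. -/
def shiftPerm : Equiv.Perm (ℤ → ℝ) where
  toFun := shiftBy 1
  invFun := shiftBy (-1)
  left_inv x := by funext m; simp [shiftBy]
  right_inv x := by funext m; simp [shiftBy]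

lemma shiftPerm_zpow (n : ℤ) : ⇑(shiftPerm ^ n : Equiv.Perm (ℤ → ℝ)) = shiftBy n := by
  induction n using Int.induction_on with
  | zero => funext x m; simp [shiftBy]
  | succ k ih =>
    rw [zpow_add_one, Equiv.Perm.coe_mul, ih]
    funext x m
    simp [shiftBy, shiftPerm, add_assoc]
  | pred k ih =>
    rw [zpow_sub_one, Equiv.Perm.coe_mul, ih]
    funext x m
    simp only [Function.comp_apply, shiftBy]
    change x _ = x _
    congr 1
    ring

lemma nullSingletonClass_of_integral_expLin {H : Type*} [NormedAddCommGroup H]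
    [InnerProductSpace ℝ H] {e : ℤ → H} (he : ‖e 0‖ = 1) {ν : Measure (ℤ → ℝ)}
    [IsProbabilityMeasure ν] (hν : ∀ t : ℤ →₀ ℝ, ∫ x, expLin t x ∂ν =
      Complex.exp (-((‖Finsupp.linearCombination ℝ e t‖ ^ 2 : ℝ) : ℂ) / 2)) :
    NullSingletonClass ν := by
  have hm : Measurable fun x : ℤ → ℝ => x 0 := measurable_pi_apply 0
  have h : ν.map (fun x : ℤ → ℝ => x 0) = gaussianReal 0 1 := by
    have := Measure.isProbabilityMeasure_map (μ := ν) hm.aemeasurable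
    refine Measure.ext_of_charFun (funext fun t => ?_)
    rw [charFun_gaussianReal, charFun_apply_real, integral_map hm.aemeasurable (by fun_prop)]
    have := hν (Finsupp.single 0 t)
    simp only [expLin, Finsupp.linearCombination_single, norm_smul, he, smul_eq_mul] at this
    push_cast at this
    simp only [this]
    congr 1
    simp [← Complex.ofReal_pow, neg_div]
  have : NullSingletonClass (gaussianReal 0 1) := nullSingletonClass_gaussianReal one_ne_zero
  refine ⟨fun x => measure_mono_null (t := (fun x : ℤ → ℝ => x 0) ⁻¹' {x 0}) ?_ ?_⟩
  · rintro _ rfl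
    rfl
  · rw [← Measure.map_apply hm (measurableSet_singleton _), h, measure_singleton]

/-- A normalised stationary covariance is realised by a transformation of `[0,1]` whose
correlations inherit rigidity (`ζ = 1`) and mixing (`ζ = 0`) from the covariance. -/
theorem exists_avgTendsto_corr {H : Type*} [NormedAddCommGroup H] [InnerProductSpace ℝ H]
    {e : ℤ → H} {c : ℤ → ℝ} (hc : ∀ i j, inner ℝ (e i) (e j) = c (j - i)) (h1 : c 0 = 1) :
    ∃ T : Aut01, ∀ (S : ℕ → Finset ℕ) (a : ℕ → ℤ) (ζ : ℝ), (ζ = 0 ∨ ζ = 1) →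
      (∀ h, AvgTendsto S fun n => |c (a n + h) - ζ * c h|) →
      ∀ A B : Set unitInterval, MeasurableSet A → MeasurableSet B →
        AvgTendsto S fun n => |T.corr (a n) A B - (ζ * (volume (A ∩ B)).toReal +
          (1 - ζ) * ((volume A).toReal * (volume B).toReal))| := by
  obtain ⟨ν, hν1, hν⟩ := exists_gaussian_measure e
  have he : ‖e 0‖ = 1 := by
    have h2 := hc 0 0
    rw [sub_zero, h1, real_inner_self_eq_norm_sq] at h2
    exact (pow_eq_one_iff_of_nonneg (norm_nonneg _) two_ne_zero).1 h2
  have := nullSingletonClass_of_integral_expLin he hν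
  obtain ⟨T, F, hF, hT⟩ := exists_corr_eq ν shiftPerm fun n => by
    rw [shiftPerm_zpow]
    exact measurePreserving_shiftBy hc hν n
  refine ⟨T, fun S a ζ hζ hS A B hA hB => ?_⟩
  convert avgTendsto_measure_inter_shiftBy hc hν hζ hS (hF.measurable hA) (hF.measurable hB)
    using 3 with n
  rw [hT _ _ _ hA hB, shiftPerm_zpow, ← Set.preimage_inter]
  simp only [measureReal_def, hF.measure_preimage hA.nullMeasurableSet,
    hF.measure_preimage hB.nullMeasurableSet,
    hF.measure_preimage (hA.inter hB).nullMeasurableSet]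

/-- The character `x ↦ exp (2πix)` of the circle `ℝ / ℤ`. -/
def phase (x : ℝ) : ℂ := Complex.exp ((2 * Real.pi * x : ℝ) * Complex.I)

lemma norm_phase (x : ℝ) : ‖phase x‖ = 1 := Complex.norm_exp_ofReal_mul_I _

lemma phase_add (x y : ℝ) : phase (x + y) = phase x * phase y := by
  simp only [phase, ← Complex.exp_add]
  congr 1
  push_cast
  ring

lemma phase_zero : phase 0 = 1 := by simp [phase]

lemma phase_int_mul (n : ℤ) (x : ℝ) : phase (n * x) = phase x ^ n := by
  rw [phase, phase, ← Complex.exp_int_mul]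
  congr 1
  push_cast
  ring

lemma phase_intCast (n : ℤ) : phase n = 1 := by
  rw [phase, Complex.exp_eq_one_iff]
  exact ⟨n, by push_cast; ring⟩

lemma conj_phase (x : ℝ) : (starRingEnd ℂ) (phase x) = phase (-x) := by
  rw [phase, ← Complex.exp_conj, map_mul, Complex.conj_ofReal, Complex.conj_I, phase]
  congr 1
  push_cast
  ring

lemma continuous_phase : Continuous phase := by
  unfold phase
  fun_prop

lemma norm_phase_sub_le (x y : ℝ) : ‖phase x - phase y‖ ≤ 2 * Real.pi * |x - y| := by
  have h : phase x - phase y = phase y * (phase (x - y) - 1) := by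
    rw [mul_sub, ← phase_add, mul_one]
    congr 2
    ring
  rw [h, norm_mul, norm_phase, one_mul, phase, mul_comm _ Complex.I]
  refine (Real.norm_exp_I_mul_ofReal_sub_one_le).trans (le_of_eq ?_)
  rw [Real.norm_eq_abs, abs_mul, abs_of_nonneg (by positivity)]

section Covariance

variable {Ω : Type*} [MeasurableSpace Ω] {P : Measure Ω} [IsProbabilityMeasure P] {θ : Ω → ℝ}

/-- The Fourier coefficients of the distribution of `θ` modulo one. -/
def fourierCoef (P : Measure Ω) (θ : Ω → ℝ) (n : ℤ) : ℂ := ∫ ω, phase (n * θ ω) ∂P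

lemma measurable_phase_mul (hθ : Measurable θ) (n : ℤ) : Measurable fun ω => phase (n * θ ω) :=
  continuous_phase.measurable.comp (hθ.const_mul _)

lemma memLp_phase_mul (hθ : Measurable θ) (n : ℤ) : MemLp (fun ω => phase (n * θ ω)) 2 P :=
  MemLp.of_bound (measurable_phase_mul hθ n).aestronglyMeasurable 1
    (ae_of_all _ fun _ => (norm_phase _).le)

/-- The real parts of the Fourier coefficients of a probability measure on the circle form a
normalised stationary covariance. -/
theorem exists_avgTendsto_corr_of_fourierCoef (P : Measure Ω) [IsProbabilityMeasure P]
    (hθ : Measurable θ) :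
    ∃ T : Aut01, ∀ (S : ℕ → Finset ℕ) (a : ℕ → ℤ) (ζ : ℝ), (ζ = 0 ∨ ζ = 1) →
      (∀ h, AvgTendsto S fun n => ‖fourierCoef P θ (a n + h) - ζ * fourierCoef P θ h‖) →
      ∀ A B : Set unitInterval, MeasurableSet A → MeasurableSet B →
        AvgTendsto S fun n => |T.corr (a n) A B - (ζ * (volume (A ∩ B)).toReal +
          (1 - ζ) * ((volume A).toReal * (volume B).toReal))| := by
  let _ : InnerProductSpace ℝ (Lp ℂ 2 P) := InnerProductSpace.rclikeToReal ℂ _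
  obtain ⟨T, hT⟩ := exists_avgTendsto_corr (e := fun n => (memLp_phase_mul (P := P) hθ n).toLp)
    (c := fun n => (fourierCoef P θ n).re) (fun i j => by
      rw [real_inner_eq_re_inner (𝕜 := ℂ), L2.inner_def, RCLike.re_eq_complex_re, fourierCoef]
      congr 1
      refine integral_congr_ae ?_
      filter_upwards [(memLp_phase_mul (P := P) hθ i).coeFn_toLp,
        (memLp_phase_mul (P := P) hθ j).coeFn_toLp] with ω hi hj
      rw [hi, hj, RCLike.inner_apply, conj_phase, ← phase_add]
      congr 1
      push_cast
      ring) (by simp [fourierCoef, phase_zero])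
  refine ⟨T, fun S a ζ hζ hS A B hA hB => hT S a ζ hζ (fun h => ?_) A B hA hB⟩
  refine (hS h).mono (fun n => abs_nonneg _) fun n => ?_
  refine le_trans (le_of_eq ?_) (Complex.abs_re_le_norm _)
  simp

/-- If `phase (a n * θ)` tends to one, then the frequencies `a n` are rigid. -/
lemma tendsto_fourierCoef_of_rigid (hθ : Measurable θ) {a : ℕ → ℤ}
    (ha : ∀ ω, Tendsto (fun k => phase (a k * θ ω)) atTop (𝓝 1)) (h : ℤ) :
    Tendsto (fun k => fourierCoef P θ (a k + h)) atTop (𝓝 (fourierCoef P θ h)) := by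
  refine tendsto_integral_of_dominated_convergence (fun _ => 1)
    (fun k => (measurable_phase_mul hθ _).aestronglyMeasurable) (integrable_const _)
    (fun k => ae_of_all _ fun ω => (norm_phase _).le) (ae_of_all _ fun ω => ?_)
  have := (ha ω).mul_const (phase (h * θ ω))
  rw [one_mul] at this
  refine this.congr fun k => ?_
  rw [← phase_add]
  push_cast
  ring_nf

/-- If `phase (a n * θ)` is asymptotic to an orthonormal sequence, it tends weakly to zero. -/
lemma tendsto_integral_phase_mul_of_orthonormal (hθ : Measurable θ) {a : ℕ → ℤ} {s : ℕ → Ω → ℂ}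
    (hsm : ∀ k, Measurable (s k)) (hsb : ∀ k ω, ‖s k ω‖ = 1)
    (hs : ∀ k l, k ≠ l → ∫ ω, (starRingEnd ℂ) (s k ω) * s l ω ∂P = 0)
    (ha : ∀ ω, Tendsto (fun k => phase (a k * θ ω) - s k ω) atTop (𝓝 0))
    {g : Ω → ℂ} (hg : Measurable g) (hgb : ∀ ω, ‖g ω‖ ≤ 1) :
    Tendsto (fun k => ∫ ω, g ω * phase (a k * θ ω) ∂P) atTop (𝓝 0) := by
  have hsL : ∀ k, MemLp (s k) 2 P := fun k =>
    MemLp.of_bound (hsm k).aestronglyMeasurable 1 (ae_of_all _ fun ω => (hsb k ω).le)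
  have hcg : Measurable fun ω => (starRingEnd ℂ) (g ω) := Complex.continuous_conj.measurable.comp hg
  have hgL : MemLp (fun ω => (starRingEnd ℂ) (g ω)) 2 P :=
    MemLp.of_bound hcg.aestronglyMeasurable 1
      (ae_of_all _ fun ω => by rw [RCLike.norm_conj]; exact hgb ω)
  have hin : ∀ {f f' : Ω → ℂ} (hf : MemLp f 2 P) (hf' : MemLp f' 2 P),
      inner ℂ hf.toLp hf'.toLp = ∫ ω, (starRingEnd ℂ) (f ω) * f' ω ∂P := by
    intro f f' hf hf'
    rw [L2.inner_def]
    refine integral_congr_ae ?_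
    filter_upwards [hf.coeFn_toLp, hf'.coeFn_toLp] with ω h1 h2
    rw [h1, h2, RCLike.inner_apply, mul_comm]
  have hon : Orthonormal ℂ fun k => (hsL k).toLp := by
    refine orthonormal_iff_ite.2 fun k l => ?_
    rw [hin]
    split_ifs with h
    · subst h
      simp [Complex.conj_mul', hsb]
    · exact hs k l h
  have h1 : Tendsto (fun k => ∫ ω, g ω * s k ω ∂P) atTop (𝓝 0) := by
    have h2 := (hon.inner_products_summable hgL.toLp).tendsto_atTop_zero
    simp only [hin] at h2
    have h3 : Tendsto (fun k => ‖∫ ω, (starRingEnd ℂ) (s k ω) * (starRingEnd ℂ) (g ω) ∂P‖)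
        atTop (𝓝 0) := by
      have := h2.sqrt
      simpa only [Real.sqrt_sq (norm_nonneg _), Real.sqrt_zero] using this
    refine tendsto_zero_iff_norm_tendsto_zero.2 (h3.congr fun k => ?_)
    rw [← RCLike.norm_conj, ← integral_conj]
    congr 2
    funext ω
    simp [mul_comm]
  have h2 : Tendsto (fun k => ∫ ω, g ω * (phase (a k * θ ω) - s k ω) ∂P) atTop (𝓝 0) := by
    rw [← integral_zero Ω ℂ (μ := P)]
    refine tendsto_integral_of_dominated_convergence (fun _ => 2)
      (fun k => (hg.mul ((measurable_phase_mul hθ _).sub (hsm k))).aestronglyMeasurable)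
      (integrable_const _) (fun k => ae_of_all _ fun ω => ?_) (ae_of_all _ fun ω => ?_)
    · rw [norm_mul]
      have h3 := norm_sub_le (phase (a k * θ ω)) (s k ω)
      rw [norm_phase, hsb] at h3
      nlinarith [hgb ω, norm_nonneg (g ω)]
    · simpa using (ha ω).const_mul (g ω)
  have h3 := h1.add h2
  rw [add_zero] at h3
  refine h3.congr fun k => ?_
  have hi : ∀ f : Ω → ℂ, Measurable f → (∀ ω, ‖f ω‖ ≤ 2) → Integrable f P := fun f hf hb =>
    Integrable.of_bound hf.aestronglyMeasurable 2 (ae_of_all _ hb)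
  rw [← integral_add]
  · congr
    funext ω
    ring
  · refine hi _ (hg.mul (hsm k)) fun ω => ?_
    rw [norm_mul, hsb]
    linarith [hgb ω]
  · refine hi _ (hg.mul ((measurable_phase_mul hθ _).sub (hsm k))) fun ω => ?_
    rw [norm_mul]
    have h3 := norm_sub_le (phase (a k * θ ω)) (s k ω)
    rw [norm_phase, hsb] at h3
    nlinarith [hgb ω, norm_nonneg (g ω)]

end Covariance

section Wiener

variable {Ω : Type*} [MeasurableSpace Ω] {P : Measure Ω} [IsProbabilityMeasure P] {θ : Ω → ℝ}

/-- If `|z| = 1` and `z ≠ 1`, then the averages of `z ^ (n + h)` tend to zero. -/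
lemma tendsto_average_zpow {z : ℂ} (hz : ‖z‖ = 1) (hz1 : z ≠ 1) (h : ℤ) :
    Tendsto (fun M : ℕ => (1 / (M : ℂ)) * ∑ n ∈ Finset.Icc 1 M, z ^ ((n : ℤ) + h))
      atTop (𝓝 0) := by
  have hz0 : z ≠ 0 := by
    rintro rfl
    simp at hz
  have hsum : ∀ M : ℕ, ∑ n ∈ Finset.Icc 1 M, z ^ ((n : ℤ) + h) =
      z ^ (h + 1) * ((z ^ M - 1) / (z - 1)) := by
    intro M
    rw [← geom_sum_eq hz1]
    induction M with
    | zero => simp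
    | succ M ih =>
      rw [Finset.sum_Icc_succ_top (Nat.le_add_left 1 M), ih, Finset.sum_range_succ, mul_add,
        ← zpow_natCast z M, ← zpow_add₀ hz0]
      congr 2
      push_cast
      ring
  rw [tendsto_zero_iff_norm_tendsto_zero]
  have hlim : Tendsto (fun M : ℕ => (1 / (M : ℝ)) * (2 / ‖z - 1‖)) atTop (𝓝 0) := by
    simpa using tendsto_one_div_atTop_nhds_zero_nat.mul_const (2 / ‖z - 1‖)
  refine squeeze_zero (fun _ => norm_nonneg _) (fun M => ?_) hlim
  rw [hsum, norm_mul, norm_mul, norm_zpow, hz, one_zpow, one_mul, norm_div, norm_div, norm_one,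
    Complex.norm_natCast]
  gcongr
  refine (norm_sub_le _ _).trans ?_
  rw [norm_pow, hz, norm_one, one_pow]
  norm_num

lemma norm_sq_fourierCoef (hθ : Measurable θ) (n : ℤ) :
    ((‖fourierCoef P θ n‖ ^ 2 : ℝ) : ℂ) =
      ∫ p, phase (p.1 - p.2) ^ n ∂(P.prod P).map (fun q => (θ q.1, θ q.2)) := by
  have hm : Measurable fun q : Ω × Ω => (θ q.1, θ q.2) :=
    (hθ.comp measurable_fst).prodMk (hθ.comp measurable_snd)
  rw [integral_map hm.aemeasurable (by
    simp only [← phase_int_mul]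
    exact (continuous_phase.comp (by fun_prop)).aestronglyMeasurable)]
  push_cast
  rw [← Complex.mul_conj', fourierCoef, ← integral_conj, ← integral_prod_mul]
  congr
  funext q
  rw [conj_phase, ← phase_add, ← phase_int_mul]
  congr 1
  ring

/-- Wiener's lemma: the Fourier coefficients of an atomless measure on the circle tend to zero in
average. -/
theorem avgTendsto_fourierCoef (hθ : Measurable θ)
    (hatom : ∀ z : ℂ, P {ω | phase (θ ω) = z} = 0) (h : ℤ) :
    AvgTendsto (fun M => Finset.Icc 1 M) fun n => ‖fourierCoef P θ (n + h)‖ := by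
  set Q := (P.prod P).map (fun q => (θ q.1, θ q.2)) with hQ
  have hm : Measurable fun q : Ω × Ω => (θ q.1, θ q.2) :=
    (hθ.comp measurable_fst).prodMk (hθ.comp measurable_snd)
  have : IsProbabilityMeasure Q := Measure.isProbabilityMeasure_map hm.aemeasurable
  have hc : ∀ n : ℤ, Continuous fun p : ℝ × ℝ => phase (p.1 - p.2) ^ n := by
    intro n
    simp only [← phase_int_mul]
    exact continuous_phase.comp (by fun_prop)
  have hae : ∀ᵐ p ∂Q, phase (p.1 - p.2) ≠ 1 := by
    have hms : MeasurableSet {p : ℝ × ℝ | phase (p.1 - p.2) ≠ 1} :=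
      (isClosed_eq (continuous_phase.comp (by fun_prop)) continuous_const).measurableSet.compl
    rw [hQ, ae_map_iff hm.aemeasurable hms]
    refine (Measure.ae_prod_iff_ae_ae (hm hms)).2 ?_
    refine ae_of_all _ fun ω => ?_
    refine measure_mono_null (fun ω' hω' => ?_) (hatom (phase (θ ω)))
    simp only [Set.mem_compl_iff, Set.mem_ofPred_eq, not_not] at hω'
    change phase (θ ω') = phase (θ ω)
    have h1 : θ ω = (θ ω - θ ω') + θ ω' := by ring
    rw [h1, phase_add, hω', one_mul]
  have hnorm : ∀ (p : ℝ × ℝ) (n : ℤ), ‖phase (p.1 - p.2) ^ n‖ = 1 := fun p n => by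
    rw [norm_zpow, norm_phase, one_zpow]
  have h1 : Tendsto (fun M : ℕ => ∫ p, (1 / (M : ℂ)) *
      ∑ n ∈ Finset.Icc 1 M, phase (p.1 - p.2) ^ ((n : ℤ) + h) ∂Q) atTop (𝓝 0) := by
    rw [← integral_zero (ℝ × ℝ) ℂ (μ := Q)]
    refine tendsto_integral_of_dominated_convergence (fun _ => 1)
      (fun M => (continuous_const.mul
        (continuous_finsetSum _ fun n _ => hc _)).aestronglyMeasurable)
      (integrable_const _) (fun M => ae_of_all _ fun p => ?_) (hae.mono fun p hp => ?_)
    · rw [norm_mul, norm_div, norm_one, Complex.norm_natCast]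
      have h2 : ‖∑ n ∈ Finset.Icc 1 M, phase (p.1 - p.2) ^ ((n : ℤ) + h)‖ ≤ M := by
        refine (norm_sum_le _ _).trans ?_
        simp [hnorm]
      calc 1 / (M : ℝ) * _ ≤ 1 / (M : ℝ) * M := by gcongr
        _ ≤ 1 := by rw [one_div_mul_eq_div]; exact div_self_le_one _
    · exact tendsto_average_zpow (norm_phase _) hp h
  have h2 : Tendsto (fun M : ℕ => (1 / (M : ℝ)) *
      ∑ n ∈ Finset.Icc 1 M, ‖fourierCoef P θ (n + h)‖ ^ 2) atTop (𝓝 0) := by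
    have h3 := (Complex.continuous_re.tendsto _).comp h1
    refine h3.congr fun M => ?_
    simp only [Function.comp_apply]
    rw [integral_const_mul, integral_finsetSum _ fun n _ =>
      Integrable.of_bound (hc _).aestronglyMeasurable 1 (ae_of_all _ fun p => (hnorm p _).le)]
    simp only [hQ, ← norm_sq_fourierCoef hθ]
    rw [← Complex.ofReal_sum, ← Complex.ofReal_natCast, ← Complex.ofReal_one,
      ← Complex.ofReal_div, ← Complex.ofReal_mul, Complex.ofReal_re]
  have h3 := h2.sqrt
  rw [Real.sqrt_zero] at h3
  refine squeeze_zero (fun M => by positivity) (fun M => ?_) h3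
  refine Real.le_sqrt_of_sq_le ?_
  rw [Nat.card_Icc, Nat.add_sub_cancel]
  rcases Nat.eq_zero_or_pos M with rfl | hM
  · simp
  have h4 := sq_sum_le_card_mul_sum_sq (s := Finset.Icc 1 M)
    (f := fun n : ℕ => ‖fourierCoef P θ (n + h)‖)
  rw [Nat.card_Icc, Nat.add_sub_cancel] at h4
  have hM' : (0 : ℝ) < M := by exact_mod_cast hM
  rw [mul_pow]
  refine (mul_le_mul_of_nonneg_left h4 (by positivity)).trans (le_of_eq ?_)
  field_simp

end Wiener

section Coins

/-- The digit of a coin. -/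
def digit (b : Bool) : ℝ := if b then 1 else 0

lemma abs_digit_mul_le (b : Bool) (x : ℝ) : |digit b * x| ≤ |x| := by
  cases b <;> simp [digit]

lemma phase_half : phase (1 / 2) = -1 := by
  rw [phase, ← Complex.exp_pi_mul_I]
  congr 1
  push_cast
  ring

/-- The distribution of a fair coin. -/
def fairCoin : Measure Bool := (2⁻¹ : ENNReal) • (Measure.dirac true + Measure.dirac false)

instance : IsProbabilityMeasure fairCoin := by
  refine ⟨?_⟩
  simp only [fairCoin, Measure.smul_apply, Measure.add_apply, measure_univ, smul_eq_mul]
  rw [one_add_one_eq_two]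
  exact ENNReal.inv_mul_cancel two_ne_zero ENNReal.ofNat_ne_top

lemma integral_fairCoin_phase : ∫ b, phase (digit b * (1 / 2)) ∂fairCoin = 0 := by
  have hi : ∀ b : Bool, Integrable (fun b => phase (digit b * (1 / 2))) (Measure.dirac b) :=
    fun b => Integrable.of_bound (measurable_of_finite _).aestronglyMeasurable 1
      (ae_of_all _ fun _ => (norm_phase _).le)
  rw [fairCoin, integral_smul_measure, integral_add_measure (hi _) (hi _), integral_dirac,
    integral_dirac]
  simp only [digit, if_true, Bool.false_eq_true, if_false, one_mul, zero_mul, phase_zero,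
    phase_half]
  simp

/-- The distribution of a sequence of independent fair coins. -/
def coins : Measure (ℕ → Bool) := Measure.infinitePi fun _ => fairCoin

instance : IsProbabilityMeasure coins := by
  unfold coins
  infer_instance

lemma integral_conj_phase_mul_phase {k l : ℕ} (hkl : k ≠ l) :
    ∫ ω, (starRingEnd ℂ) (phase (digit (ω k) * (1 / 2))) * phase (digit (ω l) * (1 / 2)) ∂coins =
      0 := by
  have hind : iIndepFun (fun (i : ℕ) (ω : ℕ → Bool) => ω i) coins :=
    iIndepFun_infinitePi (X := fun _ b => b) fun _ => measurable_id
  rw [(hind.indepFun hkl).integral_fun_comp_mul_comp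
    (f := fun b => (starRingEnd ℂ) (phase (digit b * (1 / 2))))
    (g := fun b => phase (digit b * (1 / 2))) (measurable_pi_apply k).aemeasurable
    (measurable_pi_apply l).aemeasurable (measurable_of_finite _).aestronglyMeasurable
    (measurable_of_finite _).aestronglyMeasurable]
  have h := (measurePreserving_eval_infinitePi (fun _ : ℕ => fairCoin) l)
  have h2 : ∫ ω, phase (digit (ω l) * (1 / 2)) ∂coins = ∫ b, phase (digit b * (1 / 2)) ∂fairCoin := by
    rw [← h.map_eq, integral_map h.measurable.aemeasurable
      (measurable_of_finite _).aestronglyMeasurable]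
    rfl
  rw [h2, integral_fairCoin_phase, mul_zero]

/-- The random series `∑ εₖ βₖ` with coin-tossing digits `εₖ`. -/
def randomSeries (β : ℕ → ℝ) (ω : ℕ → Bool) : ℝ := ∑' k, digit (ω k) * β k

lemma measurable_randomSeries (β : ℕ → ℝ) : Measurable (randomSeries β) := by
  refine Measurable.tsum fun k => ?_
  exact ((measurable_of_finite digit).comp (measurable_pi_apply k)).mul_const _

/-- If `a k * β l` is an integer for `l < k`, converges to `x` modulo one for `l = k`, and is
small for `l > k`, then `phase (a k * ∑ εₗ βₗ)` is asymptotic to `phase (εₖ x)`. -/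
theorem tendsto_phase_mul_randomSeries {β : ℕ → ℝ} (hβ : Summable fun k => |β k|) {a : ℕ → ℤ}
    {x K : ℝ} (hlt : ∀ᶠ k in atTop, ∀ l < k, ∃ z : ℤ, a k * β l = z)
    (heq : ∃ z : ℕ → ℤ, Tendsto (fun k => a k * β k - z k) atTop (𝓝 x))
    (hgt : ∀ k l, k < l → |a k * β l| ≤ K * (1 / 2) ^ l) (ω : ℕ → Bool) :
    Tendsto (fun k => phase (a k * randomSeries β ω) - phase (digit (ω k) * x)) atTop (𝓝 0) := by
  obtain ⟨z, hz⟩ := heq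
  have hsum : Summable fun k => digit (ω k) * β k :=
    Summable.of_norm_bounded hβ fun k => abs_digit_mul_le _ _
  set tail : ℕ → ℝ := fun k => ∑' l, digit (ω (l + (k + 1))) * (a k * β (l + (k + 1))) with htail
  have hgeom : ∀ k, HasSum (fun l : ℕ => K * (1 / 2 : ℝ) ^ (l + (k + 1))) (K * (1 / 2) ^ k) := by
    intro k
    have h := (hasSum_geometric_two.mul_right ((1 / 2 : ℝ) ^ (k + 1))).mul_left K
    have h1 : K * (2 * (1 / 2 : ℝ) ^ (k + 1)) = K * (1 / 2) ^ k := by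
      rw [pow_succ]
      ring
    rw [h1] at h
    exact h.congr_fun fun l => by rw [pow_add]
  have htb : ∀ k, |tail k| ≤ K * (1 / 2) ^ k := fun k => by
    have h : ∀ l, ‖digit (ω (l + (k + 1))) * (a k * β (l + (k + 1)))‖ ≤
        K * (1 / 2) ^ (l + (k + 1)) := fun l =>
      (abs_digit_mul_le _ _).trans (hgt k _ (by omega))
    exact tsum_of_norm_bounded (hgeom k) h
  have hdec : ∀ᶠ k in atTop, phase (a k * randomSeries β ω) =
      phase (digit (ω k) * (a k * β k - z k) + tail k) := by
    filter_upwards [hlt] with k hk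
    have h1 : ∃ y : ℤ, ∑ l ∈ Finset.range k, digit (ω l) * (a k * β l) = y := by
      choose! y hy using hk
      refine ⟨∑ l ∈ Finset.range k, if ω l then y l else 0, ?_⟩
      push_cast
      refine Finset.sum_congr rfl fun l hl => ?_
      rw [hy l (Finset.mem_range.1 hl)]
      cases ω l <;> simp [digit]
    obtain ⟨y, hy⟩ := h1
    obtain ⟨y', hy'⟩ : ∃ y' : ℤ, digit (ω k) * z k = y' := by
      cases ω k
      · exact ⟨0, by simp [digit]⟩
      · exact ⟨z k, by simp [digit]⟩
    have h2 : a k * randomSeries β ω =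
        ((y + y' : ℤ) : ℝ) + (digit (ω k) * (a k * β k - z k) + tail k) := by
      rw [randomSeries, ← hsum.sum_add_tsum_nat_add (k + 1), mul_add, ← tsum_mul_left,
        Finset.mul_sum, Finset.sum_range_succ]
      push_cast
      rw [← hy, ← hy', htail]
      simp only [mul_left_comm (a k : ℝ)]
      ring
    rw [h2, phase_add, phase_intCast, one_mul]
  have hlim : Tendsto (fun k => 2 * Real.pi * (|a k * β k - z k - x| + K * (1 / 2) ^ k))
      atTop (𝓝 0) := by
    have h1 : Tendsto (fun k => |a k * β k - z k - x|) atTop (𝓝 0) := by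
      simpa using (hz.sub_const x).abs
    have h2 := (tendsto_pow_atTop_nhds_zero_of_lt_one (r := (1 / 2 : ℝ)) (by norm_num)
      (by norm_num)).const_mul K
    simpa using (h1.add h2).const_mul (2 * Real.pi)
  refine squeeze_zero_norm' ?_ hlim
  filter_upwards [hdec] with k hk
  rw [hk]
  refine (norm_phase_sub_le _ _).trans (mul_le_mul_of_nonneg_left ?_ (by positivity))
  have h1 : digit (ω k) * (a k * β k - z k) + tail k - digit (ω k) * x =
      digit (ω k) * (a k * β k - z k - x) + tail k := by ring
  rw [h1]
  exact (abs_add_le _ _).trans (add_le_add (abs_digit_mul_le _ _) (htb k))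

end Coins

section Arithmetic

/-- Convergence of a real sequence modulo the integers. -/
def TendstoModInt (f : ℕ → ℝ) (L : ℝ) : Prop :=
  ∃ z : ℕ → ℤ, Tendsto (fun k => f k - z k) atTop (𝓝 L)

lemma TendstoModInt.sum {ι : Type*} {s : Finset ι} {f : ι → ℕ → ℝ} {L : ι → ℝ}
    (h : ∀ i ∈ s, TendstoModInt (f i) (L i)) :
    TendstoModInt (fun k => ∑ i ∈ s, f i k) (∑ i ∈ s, L i) := by
  choose! z hz using h
  refine ⟨fun k => ∑ i ∈ s, z i k, ?_⟩
  refine (tendsto_finsetSum s hz).congr fun k => ?_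
  push_cast
  rw [Finset.sum_sub_distrib]

lemma tendstoModInt_pow_div_pow {n : ℕ → ℕ} (hn : Tendsto n atTop atTop) {D : ℕ} (hD : 0 < D)
    (hdvd : ∀ᶠ k in atTop, D ∣ n k) (c : ℤ) (i j : ℕ) :
    TendstoModInt (fun k => (c : ℝ) / D * ((n k : ℝ) ^ i / (n k : ℝ) ^ j))
      (if i = j then (c : ℝ) / D else 0) := by
  have hpos : ∀ᶠ k in atTop, (n k : ℝ) ≠ 0 := by
    filter_upwards [hn.eventually_ge_atTop 1] with k hk
    have : n k ≠ 0 := by omega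
    exact_mod_cast this
  have hD' : (D : ℝ) ≠ 0 := by exact_mod_cast hD.ne'
  rcases lt_trichotomy i j with h | h | h
  · refine ⟨fun _ => 0, ?_⟩
    rw [if_neg h.ne]
    have h1 : Tendsto (fun k => (c : ℝ) / D * ((n k : ℝ) ^ (j - i))⁻¹) atTop (𝓝 ((c : ℝ) / D * 0)) :=
      (((tendsto_pow_atTop (by omega : j - i ≠ 0)).comp
        (tendsto_natCast_atTop_atTop.comp hn)).inv_tendsto_atTop).const_mul _
    rw [mul_zero] at h1
    refine h1.congr' ?_
    filter_upwards [hpos] with k hk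
    rw [pow_sub₀ _ hk h.le]
    field_simp
    simp
  · refine ⟨fun _ => 0, ?_⟩
    rw [if_pos h]
    refine tendsto_const_nhds.congr' ?_
    filter_upwards [hpos] with k hk
    rw [h, div_self (pow_ne_zero _ hk)]
    simp
  · refine ⟨fun k => c * (n k) ^ (i - j) / D, ?_⟩
    rw [if_neg h.ne']
    refine tendsto_const_nhds.congr' ?_
    filter_upwards [hpos, hdvd] with k hk hkd
    have h2 : (D : ℤ) ∣ c * (n k) ^ (i - j) :=
      Dvd.dvd.mul_left ((Int.natCast_dvd_natCast.2 hkd).trans (dvd_pow_self _ (by omega))) c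
    rw [Int.cast_div h2 (by exact_mod_cast hD')]
    push_cast
    rw [pow_sub₀ _ hk h.le]
    field_simp
    simp

/-- A sequence growing so fast, and so divisible, that the values of integer polynomials along it
multiply the numbers `∑ Wᵢ / (2 D nₖⁱ)` into controlled position modulo the integers. -/
structure FastGrowing (d : ℕ) (n : ℕ → ℕ) : Prop where
  pos : ∀ k, 1 ≤ n k
  growth : ∀ k l, l < k → 2 ^ k * n l ^ d ≤ n k
  dvd : ∀ D, 0 < D → ∀ᶠ k in atTop, ∀ l < k, D * n l ^ d ∣ n k

lemma exists_fastGrowing (d : ℕ) (m : ℕ → ℕ) (hm : StrictMono m)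
    (hfac : ∀ k, Nat.factorial k ∣ m k) :
    ∃ r : ℕ → ℕ, StrictMono r ∧ FastGrowing d fun k => m (r k) := by
  let r : ℕ → ℕ := fun k => Nat.rec 1 (fun k x => x + 1 + 2 ^ (k + 1) * m x ^ d) k
  have hr : ∀ k, r (k + 1) = r k + 1 + 2 ^ (k + 1) * m (r k) ^ d := fun k => rfl
  have hmono : StrictMono r := strictMono_nat_of_lt_succ fun k => by
    rw [hr]
    omega
  have hr1 : ∀ k, 1 ≤ r k := fun k => hmono.monotone (Nat.zero_le k)
  have hgrow : ∀ k l, l < k → 2 ^ k * m (r l) ^ d ≤ r k := by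
    intro k l hl
    obtain ⟨k, rfl⟩ : ∃ k', k = k' + 1 := ⟨k - 1, by omega⟩
    have h1 : m (r l) ≤ m (r k) := hm.monotone (hmono.monotone (by omega))
    calc 2 ^ (k + 1) * m (r l) ^ d ≤ 2 ^ (k + 1) * m (r k) ^ d := by gcongr
      _ ≤ r (k + 1) := by rw [hr]; omega
  have hpos : ∀ k, 1 ≤ m (r k) := fun k => (hr1 k).trans (hm.le_apply)
  refine ⟨r, hmono, hpos, fun k l hl => (hgrow k l hl).trans hm.le_apply, fun D hD => ?_⟩
  filter_upwards [eventually_ge_atTop D] with k hk l hl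
  refine (Nat.dvd_factorial (Nat.mul_pos hD (pow_pos (hpos l) d)) ?_).trans (hfac (r k))
  refine le_trans (Nat.mul_le_mul_right _ ?_) (hgrow k l hl)
  exact hk.trans Nat.lt_two_pow_self.le

variable {d : ℕ} {n : ℕ → ℕ}

lemma FastGrowing.two_pow_le (hn : FastGrowing d n) (k : ℕ) : 2 ^ k ≤ n k := by
  rcases Nat.eq_zero_or_pos k with rfl | hk
  · exact hn.pos 0
  · exact (Nat.le_mul_of_pos_right _ (pow_pos (hn.pos 0) d)).trans (hn.growth k 0 hk)

lemma FastGrowing.tendsto (hn : FastGrowing d n) : Tendsto n atTop atTop :=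
  tendsto_atTop_mono (fun k => Nat.lt_two_pow_self.le.trans (hn.two_pow_le k)) tendsto_id

lemma FastGrowing.eventually_dvd (hn : FastGrowing d n) {D : ℕ} (hD : 0 < D) :
    ∀ᶠ k in atTop, D ∣ n k := by
  filter_upwards [hn.dvd D hD, eventually_gt_atTop 0] with k hk hk0
  exact (dvd_mul_right _ _).trans (hk 0 hk0)

/-- The numbers `∑ Wᵢ / (D nₖⁱ)`. -/
def invPowSum (d : ℕ) (n : ℕ → ℕ) (W : ℕ → ℤ) (D : ℕ) (k : ℕ) : ℝ :=
  ∑ i ∈ Finset.Icc 1 d, (W i : ℝ) / D * (1 / (n k : ℝ) ^ i)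

lemma abs_invPowSum_le (hn : FastGrowing d n) (W : ℕ → ℤ) {D : ℕ} (hD : 0 < D) (k : ℕ) :
    |invPowSum d n W D k| ≤ (∑ i ∈ Finset.Icc 1 d, |(W i : ℝ)|) * (1 / n k) := by
  rw [invPowSum, Finset.sum_mul]
  refine (Finset.abs_sum_le_sum_abs _ _).trans (Finset.sum_le_sum fun i hi => ?_)
  have h1 : (1 : ℝ) ≤ n k := by exact_mod_cast hn.pos k
  have hD1 : (1 : ℝ) ≤ D := by exact_mod_cast hD
  have h2 : (n k : ℝ) ≤ (n k : ℝ) ^ i := le_self_pow₀ h1 (by have := Finset.mem_Icc.1 hi; omega)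
  rw [abs_mul, abs_div, abs_of_nonneg (by positivity : (0 : ℝ) ≤ D),
    abs_of_nonneg (by positivity : 0 ≤ 1 / (n k : ℝ) ^ i)]
  gcongr
  exact div_le_self (abs_nonneg _) hD1

lemma summable_abs_invPowSum (hn : FastGrowing d n) (W : ℕ → ℤ) {D : ℕ} (hD : 0 < D) :
    Summable fun k => |invPowSum d n W D k| := by
  refine Summable.of_nonneg_of_le (fun _ => abs_nonneg _) (fun k => ?_)
    (summable_geometric_two.mul_left (∑ i ∈ Finset.Icc 1 d, |(W i : ℝ)|))
  refine (abs_invPowSum_le hn W hD k).trans (mul_le_mul_of_nonneg_left ?_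
    (Finset.sum_nonneg fun _ _ => abs_nonneg _))
  rw [one_div_pow]
  have : (2 : ℝ) ^ k ≤ n k := by exact_mod_cast hn.two_pow_le k
  gcongr

lemma eval_eq_sum_Icc {u : Polynomial ℤ} (h0 : u.eval 0 = 0) (hd : u.natDegree ≤ d) (x : ℤ) :
    u.eval x = ∑ i ∈ Finset.Icc 1 d, u.coeff i * x ^ i := by
  rw [Polynomial.eval_eq_sum_range' (Nat.lt_succ_of_le hd), Finset.sum_range_succ',
    Polynomial.coeff_zero_eq_eval_zero, h0, zero_mul, add_zero, Finset.range_eq_Ico,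
    Finset.sum_Ico_add' (fun i => u.coeff i * x ^ i) 0 d 1]
  rfl

lemma abs_eval_le {u : Polynomial ℤ} (h0 : u.eval 0 = 0) (hd : u.natDegree ≤ d) {x : ℕ}
    (hx : 1 ≤ x) :
    |((u.eval (x : ℤ) : ℤ) : ℝ)| ≤ (∑ i ∈ Finset.Icc 1 d, |(u.coeff i : ℝ)|) * (x : ℝ) ^ d := by
  rw [eval_eq_sum_Icc h0 hd, Finset.sum_mul]
  push_cast
  refine (Finset.abs_sum_le_sum_abs _ _).trans (Finset.sum_le_sum fun i hi => ?_)
  rw [abs_mul, abs_of_nonneg (by positivity : (0 : ℝ) ≤ (x : ℝ) ^ i)]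
  have hx' : (1 : ℝ) ≤ x := by exact_mod_cast hx
  gcongr
  exact (Finset.mem_Icc.1 hi).2

/-- Behaviour of `phase (u (nₖ) θ)` for the random series with coefficients `∑ Wᵢ / (D nₖⁱ)`. -/
theorem tendsto_phase_eval_mul (hn : FastGrowing d n) (W : ℕ → ℤ) {D : ℕ} (hD : 0 < D)
    {u : Polynomial ℤ} (h0 : u.eval 0 = 0) (hd : u.natDegree ≤ d) {x : ℝ}
    (hx : ∑ i ∈ Finset.Icc 1 d, (u.coeff i : ℝ) * W i = D * x) (ω : ℕ → Bool) :
    Tendsto (fun k => phase ((u.eval (n k : ℤ) : ℤ) * randomSeries (invPowSum d n W D) ω) -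
      phase (digit (ω k) * x)) atTop (𝓝 0) := by
  have hD' : (D : ℝ) ≠ 0 := by exact_mod_cast hD.ne'
  refine tendsto_phase_mul_randomSeries (summable_abs_invPowSum hn W hD)
    (K := (∑ i ∈ Finset.Icc 1 d, |(u.coeff i : ℝ)|) * ∑ i ∈ Finset.Icc 1 d, |(W i : ℝ)|)
    ?_ ?_ (fun k l hkl => ?_) ω
  · filter_upwards [hn.dvd D hD] with k hk l hl
    have h1 : (n k : ℤ) ∣ u.eval (n k : ℤ) := by
      simpa [h0] using Polynomial.sub_dvd_eval_sub (n k : ℤ) 0 u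
    obtain ⟨q, hq⟩ := (Int.natCast_dvd_natCast.2 (hk l hl)).trans h1
    refine ⟨q * ∑ i ∈ Finset.Icc 1 d, W i * (n l : ℤ) ^ (d - i), ?_⟩
    rw [hq, invPowSum]
    push_cast
    rw [Finset.mul_sum, Finset.mul_sum]
    refine Finset.sum_congr rfl fun i hi => ?_
    have hnl : (n l : ℝ) ≠ 0 := by
      have := hn.pos l
      exact_mod_cast (by omega : n l ≠ 0)
    rw [pow_sub₀ _ hnl (Finset.mem_Icc.1 hi).2]
    field_simp
  · have h1 := TendstoModInt.sum (s := Finset.Icc 1 d ×ˢ Finset.Icc 1 d) fun p _ =>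
      tendstoModInt_pow_div_pow hn.tendsto hD (hn.eventually_dvd hD) (u.coeff p.1 * W p.2) p.1 p.2
    have h2 : ∑ p ∈ Finset.Icc 1 d ×ˢ Finset.Icc 1 d,
        (if p.1 = p.2 then ((u.coeff p.1 * W p.2 : ℤ) : ℝ) / D else 0) = x := by
      rw [Finset.sum_product, ← mul_div_cancel_left₀ x hD', ← hx, Finset.sum_div]
      refine Finset.sum_congr rfl fun i hi => ?_
      rw [Finset.sum_ite_eq, if_pos hi]
      push_cast
      rfl
    rw [h2] at h1
    obtain ⟨z, hz⟩ := h1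
    refine ⟨z, hz.congr fun k => ?_⟩
    congr 1
    rw [eval_eq_sum_Icc h0 hd, invPowSum]
    push_cast
    rw [Finset.sum_mul_sum, Finset.sum_product]
    refine Finset.sum_congr rfl fun i _ => Finset.sum_congr rfl fun j _ => ?_
    ring
  · have h1 := abs_eval_le h0 hd (hn.pos k)
    have h2 := abs_invPowSum_le hn W hD l
    have h3 : (n k : ℝ) ^ d * (1 / n l) ≤ (1 / 2) ^ l := by
      have h4 : (2 : ℝ) ^ l * (n k : ℝ) ^ d ≤ n l := by exact_mod_cast hn.growth l k hkl
      have h5 : (0 : ℝ) < n l := by exact_mod_cast hn.pos l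
      rw [mul_one_div, div_le_iff₀ h5, one_div_pow, one_div_mul_eq_div, le_div_iff₀ (by positivity)]
      linarith
    rw [abs_mul]
    calc _ ≤ _ := mul_le_mul h1 h2 (abs_nonneg _) (by positivity)
      _ = ((∑ i ∈ Finset.Icc 1 d, |(u.coeff i : ℝ)|) * ∑ i ∈ Finset.Icc 1 d, |(W i : ℝ)|) *
          ((n k : ℝ) ^ d * (1 / n l)) := by ring
      _ ≤ _ := mul_le_mul_of_nonneg_left h3 (by positivity)

end Arithmetic

/-- A linear functional with prescribed values on linearly independent polynomials without constant
term, cleared of denominators and normalised at a monomial of larger degree. -/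
lemma exists_weights {N d : ℕ} (v : Fin N → Polynomial ℤ)
    (hli : ∀ a : Fin N → ℤ, ∑ j, Polynomial.C (a j) * v j = 0 → a = 0)
    (h0 : ∀ j, (v j).eval 0 = 0) (hd : ∀ j, (v j).natDegree < d) (ξ : Fin N → ℚ) :
    ∃ (W : ℕ → ℤ) (D : ℕ), 0 < D ∧ W d = D ∧
      ∀ j, ∑ i ∈ Finset.Icc 1 d, ((v j).coeff i : ℚ) * W i = D * ξ j := by
  let ι : Polynomial ℤ →ₗ[ℤ] (ℕ → ℚ) :=
    { toFun := fun p i => p.coeff i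
      map_add' := fun p q => by funext i; simp
      map_smul' := fun c p => by funext i; simp }
  have hι : Function.Injective ι := fun p q h => Polynomial.ext fun i => by
    exact Int.cast_injective (α := ℚ) (congrFun h i)
  have hZ : LinearIndependent ℤ v := by
    refine Fintype.linearIndependent_iff.2 fun a ha j => ?_
    simp only [Polynomial.smul_eq_C_mul] at ha
    exact congrFun (hli a ha) j
  have hQ : LinearIndependent ℚ fun j => ι (v j) :=
    (LinearIndependent.iff_fractionRing ℤ ℚ).1
      (hZ.map' ι (LinearMap.ker_eq_bot.2 hι))
  obtain ⟨f, hf⟩ := LinearMap.exists_extend (Finsupp.linearCombination ℚ ξ ∘ₗ hQ.repr)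
  have hfv : ∀ j, f (ι (v j)) = ξ j := by
    intro j
    let y : Submodule.span ℚ (Set.range fun j => ι (v j)) :=
      ⟨ι (v j), Submodule.subset_span ⟨j, rfl⟩⟩
    have h1 : f (ι (v j)) = Finsupp.linearCombination ℚ ξ (hQ.repr y) := LinearMap.congr_fun hf y
    rw [h1, hQ.repr_eq_single j y rfl]
    simp
  let w : ℕ → ℚ := fun i => f (Pi.single i 1)
  have hw : ∀ j, ∑ i ∈ Finset.Icc 1 d, ((v j).coeff i : ℚ) * w i = ξ j := by
    intro j
    rw [← hfv j]
    have h1 : ι (v j) = ∑ i ∈ Finset.Icc 1 d, ((v j).coeff i : ℚ) • Pi.single i (1 : ℚ) := by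
      funext k
      change ((v j).coeff k : ℚ) = _
      simp only [Finset.sum_apply, Pi.smul_apply, Pi.single_apply, smul_eq_mul, mul_ite, mul_one,
        mul_zero, Finset.sum_ite_eq, Finset.mem_Icc]
      split_ifs with hk
      · rfl
      · rcases Nat.eq_zero_or_pos k with rfl | hk0
        · rw [Polynomial.coeff_zero_eq_eval_zero, h0, Int.cast_zero]
        · rw [Polynomial.coeff_eq_zero_of_natDegree_lt ((hd j).trans (by omega)), Int.cast_zero]
    rw [h1, map_sum]
    simp [w]
  let D : ℕ := ∏ i ∈ Finset.Icc 1 d, (w i).den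
  have hD : 0 < D := Finset.prod_pos fun i _ => (w i).den_pos
  have hW : ∀ i ∈ Finset.Icc 1 d, ∃ z : ℤ, (z : ℚ) = D * w i := by
    intro i hi
    obtain ⟨q, hq⟩ := Finset.dvd_prod_of_mem (fun i => (w i).den) hi
    refine ⟨(w i).num * q, ?_⟩
    simp only [D, hq]
    push_cast
    rw [← Rat.mul_den_eq_num]
    ring
  choose! W hW using hW
  refine ⟨fun i => if i = d then D else W i, D, hD, if_pos rfl, fun j => ?_⟩
  rw [← hw j, Finset.mul_sum]
  refine Finset.sum_congr rfl fun i hi => ?_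
  dsimp only
  split_ifs with h
  · rw [h, Polynomial.coeff_eq_zero_of_natDegree_lt (hd j)]
    simp
  · rw [hW i hi]
    ring

section RandomSeries

variable {β : ℕ → ℝ}

/-- The condition that `phase (a k * θ)` is asymptotic to `phase (εₖ x)`, where `θ = ∑ εₖ βₖ`. -/
def AsympPhase (β : ℕ → ℝ) (a : ℕ → ℤ) (x : ℝ) : Prop :=
  ∀ ω, Tendsto (fun k => phase (a k * randomSeries β ω) - phase (digit (ω k) * x)) atTop (𝓝 0)

lemma AsympPhase.tendsto_integral {a : ℕ → ℤ} (ha : AsympPhase β a (1 / 2))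
    {g : (ℕ → Bool) → ℂ} (hg : Measurable g) (hgb : ∀ ω, ‖g ω‖ ≤ 1) :
    Tendsto (fun k => ∫ ω, g ω * phase (a k * randomSeries β ω) ∂coins) atTop (𝓝 0) :=
  tendsto_integral_phase_mul_of_orthonormal (measurable_randomSeries β)
    (fun k => (measurable_of_finite fun b => phase (digit b * (1 / 2))).comp (measurable_pi_apply k))
    (fun _ _ => norm_phase _) (fun _ _ => integral_conj_phase_mul_phase) ha hg hgb

lemma AsympPhase.measure_phase_eq {a : ℕ → ℤ} (ha : AsympPhase β a (1 / 2)) (z : ℂ) :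
    coins {ω | phase (randomSeries β ω) = z} = 0 := by
  have hm := measurable_randomSeries β
  set E := {ω | phase (randomSeries β ω) = z} with hE
  have hEm : MeasurableSet E := (continuous_phase.measurable.comp hm) (measurableSet_singleton z)
  have h1 := ha.tendsto_integral (g := E.indicator 1) (measurable_one.indicator hEm) fun ω => by
    refine (norm_indicator_le_norm_self _ _).trans ?_
    simp
  have h2 : ∀ k, ‖∫ ω, E.indicator 1 ω * phase (a k * randomSeries β ω) ∂coins‖ =
      coins.real E := by
    intro k
    have h3 : ∀ ω, E.indicator (1 : (ℕ → Bool) → ℂ) ω * phase (a k * randomSeries β ω) =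
        E.indicator (fun _ => z ^ a k) ω := by
      intro ω
      by_cases h : ω ∈ E
      · rw [Set.indicator_of_mem h, Set.indicator_of_mem h, phase_int_mul, Pi.one_apply, one_mul]
        rw [show phase (randomSeries β ω) = z from h]
      · rw [Set.indicator_of_notMem h, Set.indicator_of_notMem h, zero_mul]
    simp only [h3]
    rw [integral_indicator_const _ hEm, norm_smul, Real.norm_of_nonneg measureReal_nonneg, norm_zpow]
    rcases E.eq_empty_or_nonempty with h | ⟨ω, hω⟩
    · simp [h]
    · rw [← (show phase (randomSeries β ω) = z from hω), norm_phase, one_zpow, mul_one]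
  have h3 := h1.norm
  simp only [h2, norm_zero] at h3
  have h4 := tendsto_nhds_unique tendsto_const_nhds h3
  exact (measureReal_eq_zero_iff).1 h4

lemma AsympPhase.tendsto_fourierCoef {a : ℕ → ℤ} {ξ : ℝ} (hξ : ξ = 0 ∨ ξ = 1)
    (ha : AsympPhase β a (ξ / 2)) (h : ℤ) :
    Tendsto (fun k => fourierCoef coins (randomSeries β) (a k + h)) atTop
      (𝓝 ((1 - ξ : ℝ) * fourierCoef coins (randomSeries β) h)) := by
  have hm := measurable_randomSeries β
  rcases hξ with rfl | rfl
  · simp only [sub_zero, Complex.ofReal_one, one_mul]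
    refine tendsto_fourierCoef_of_rigid hm (fun ω => ?_) h
    have := (ha ω).add_const 1
    simpa only [zero_div, mul_zero, phase_zero, sub_add_cancel, zero_add] using this
  · simp only [sub_self, Complex.ofReal_zero, zero_mul]
    refine (ha.tendsto_integral (measurable_phase_mul hm h) fun ω => (norm_phase _).le).congr
      fun k => integral_congr_ae (ae_of_all _ fun ω => ?_)
    dsimp only
    rw [← phase_add]
    push_cast
    ring_nf

lemma avgTendsto_singleton {f : ℕ → ℝ} : AvgTendsto (fun k => {k}) f ↔ Tendsto f atTop (𝓝 0) := by
  simp [AvgTendsto]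

/-- A transformation of `[0,1]` with prescribed limits of correlations. -/
theorem exists_weaklyMixing_of_asympPhase {b : ℕ → ℤ} (hb : AsympPhase β b (1 / 2)) :
    ∃ T : Aut01, T.WeaklyMixing ∧ ∀ (a : ℕ → ℤ) (ξ : ℝ), (ξ = 0 ∨ ξ = 1) →
      AsympPhase β a (ξ / 2) → ∀ A B : Set unitInterval, MeasurableSet A → MeasurableSet B →
        Tendsto (fun k => T.corr (a k) A B) atTop
          (𝓝 ((1 - ξ) * (volume (A ∩ B)).toReal + ξ * (volume A).toReal * (volume B).toReal)) := by
  have hm := measurable_randomSeries β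
  obtain ⟨T, hT⟩ := exists_avgTendsto_corr_of_fourierCoef coins hm
  refine ⟨T, fun A B hA hB => ?_, fun a ξ hξ ha A B hA hB => ?_⟩
  · have h1 := hT (fun M => Finset.Icc 1 M) (fun n => n) 0 (Or.inl rfl) (fun h => by
      simpa only [Complex.ofReal_zero, zero_mul, sub_zero] using
        avgTendsto_fourierCoef hm hb.measure_phase_eq h) A B hA hB
    simpa [AvgTendsto] using h1
  · have hζ : (1 - ξ = 0 ∨ 1 - ξ = 1) := by
      rcases hξ with rfl | rfl <;> simp
    have h1 := hT (fun k => {k}) a (1 - ξ) hζ (fun h => by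
      rw [avgTendsto_singleton, ← tendsto_iff_norm_sub_tendsto_zero]
      exact ha.tendsto_fourierCoef hξ h) A B hA hB
    rw [avgTendsto_singleton] at h1
    simp only [← Real.norm_eq_abs] at h1
    rw [← tendsto_iff_norm_sub_tendsto_zero] at h1
    convert h1 using 2
    ring

end RandomSeries

end Aut01

/-- Let `(m_k)` be strictly increasing with `k! ∣ m_k`, and let
`v_1,…,v_N ∈ ℤ[x]` be non-constant, ℚ-linearly independent, with `v_j(0)=0`. Then
there is a subsequence `(n_k) = (m_{r_k})` such that for every `ξ ∈ {0,1}^N` there is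
a weakly mixing `T_ξ` with `μ(A ∩ T_ξ^{-v_j(n_k)}B) → (1-ξ_j)μ(A∩B) + ξ_j μ(A)μ(B)`
for all `j` and measurable `A,B`. -/
theorem stmt_10 (N : ℕ) (m : ℕ → ℕ) (hm : StrictMono m)
    (hfac : ∀ k, Nat.factorial k ∣ m k)
    (v : Fin N → Polynomial ℤ) (hnc : ∀ j, 0 < (v j).natDegree)
    (hli : ∀ a : Fin N → ℤ, ∑ j, Polynomial.C (a j) * v j = 0 → a = 0)
    (h0 : ∀ j, (v j).eval 0 = 0) :
    ∃ r : ℕ → ℕ, StrictMono r ∧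
      ∀ ξ : Fin N → ℝ, (∀ j, ξ j = 0 ∨ ξ j = 1) →
        ∃ T : Aut01, T.WeaklyMixing ∧
          ∀ j : Fin N, ∀ A B : Set unitInterval, MeasurableSet A → MeasurableSet B →
            Tendsto (fun k => T.corr ((v j).eval ((m (r k) : ℤ))) A B) atTop
              (𝓝 ((1 - ξ j) * (volume (A ∩ B)).toReal
                + ξ j * (volume A).toReal * (volume B).toReal)) := by
  set d := (∑ j, (v j).natDegree) + 1 with hd
  have hdeg : ∀ j, (v j).natDegree < d := fun j =>
    Nat.lt_succ_of_le
    (Finset.single_le_sum (f := fun j => (v j).natDegree) (fun i _ => Nat.zero_le _)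
      (Finset.mem_univ j))
  obtain ⟨r, hr, hn⟩ := Aut01.exists_fastGrowing d m hm hfac
  refine ⟨r, hr, fun ξ hξ => ?_⟩
  choose ξ' hξ' using fun j => show ∃ q : ℚ, (q : ℝ) = ξ j by
    rcases hξ j with h | h
    · exact ⟨0, by simp [h]⟩
    · exact ⟨1, by simp [h]⟩
  obtain ⟨W, D, hD, hWd, hW⟩ := Aut01.exists_weights v hli h0 hdeg ξ'
  have hD2 : 0 < 2 * D := by omega
  have hphase : ∀ (u : Polynomial ℤ) (y : ℝ), u.eval 0 = 0 → u.natDegree ≤ d →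
      ∑ i ∈ Finset.Icc 1 d, (u.coeff i : ℝ) * W i = D * y →
      Aut01.AsympPhase (Aut01.invPowSum d (fun k => m (r k)) W (2 * D))
        (fun k => u.eval (m (r k) : ℤ)) (y / 2) := by
    intro u y hu0 hud hu ω
    refine Aut01.tendsto_phase_eval_mul hn W hD2 hu0 hud ?_ ω
    rw [hu]
    push_cast
    ring
  obtain ⟨T, hT, hlim⟩ := Aut01.exists_weaklyMixing_of_asympPhase
    (hphase (Polynomial.X ^ d) 1 (by simp [hd]) (by simp) (by
      have hd1 : 1 ≤ d := by omega
      simp [Polynomial.coeff_X_pow, hWd, hd1]))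
  refine ⟨T, hT, fun j A B hA hB => hlim _ (ξ j) (hξ j) ?_ A B hA hB⟩
  refine hphase (v j) (ξ j) (h0 j) (hdeg j).le ?_
  rw [← hξ' j]
  exact_mod_cast congrArg (Rat.cast : ℚ → ℝ) (hW j)
end
end
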